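/- arXiv:1012.3673 — 2 statements merged into one kernel-verified Lean document; each statement's English description precedes it below -/
import Mathlib

section
/- Let 0 < R < T. Let q_b be a smooth radial function on ℝ³ (i.e. q_b(x) depends only on |x|) and let u_b be a C² solution of the Goursat problem for q_b on the cone {(x,t) : t ≥ |x|}. Let q be a smooth function on ℝ³ and let u be a C² function on the cone {(x,t) : t ≥ |x|} satisfying the linearized equation ∂_t²u − Δu − q_b·u = q·u_b for t > |x| and u(x,|x|) = ∫₀¹ q(σx) dσ for all x. If u = 0 and ∂_r u = 0 at every point of the cylinder C = {(x,t) : |x| = R, R ≤ t ≤ T}, then q = 0 on the annulus A = {x ∈ ℝ³ : R ≤ |x| ≤ (R+T)/2}. -/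
noncomputable section

open Real MeasureTheory Metric Set

/-- Euclidean 3-space. -/
abbrev E3 : Type := EuclideanSpace ℝ (Fin 3)

/-- The `i`-th standard basis vector of `ℝ³`. -/
def basis3 (i : Fin 3) : E3 := EuclideanSpace.single i 1

/-- The partial derivative `∂ᵢ f` of a function on `ℝ³`. -/
def pd (i : Fin 3) (f : E3 → ℝ) (x : E3) : ℝ := fderiv ℝ f x (basis3 i)

/-- The Laplacian `Δf` on `ℝ³`. -/
def lap (f : E3 → ℝ) (x : E3) : ℝ := ∑ i, pd i (pd i f) x

/-- The radial derivative `∂_r f(x) = (x/|x|)·∇f(x)`. -/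
def pdr (f : E3 → ℝ) (x : E3) : ℝ := ‖x‖⁻¹ * ∑ i, x i * pd i f x

/-- The angular derivative `Ω_{ij} f = xᵢ ∂ⱼ f − xⱼ ∂ᵢ f`. -/
def ang (i j : Fin 3) (f : E3 → ℝ) (x : E3) : ℝ := x i * pd j f x - x j * pd i f x

/-- `Ω f = Σ_{i<j} Ω_{ij}(Ω_{ij} f)`. -/
def angLap (f : E3 → ℝ) (x : E3) : ℝ :=
  ∑ i, ∑ j, if i < j then ang i j (ang i j f) x else 0

/-- The squared length `|∇f(x)|²` of the gradient. -/
def gradsq (f : E3 → ℝ) (x : E3) : ℝ := ∑ i, (pd i f x) ^ 2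

/-- `Σ_{i<j} (Ω_{ij} g)²`. -/
def angsq (g : E3 → ℝ) (x : E3) : ℝ := ∑ i, ∑ j, if i < j then (ang i j g x) ^ 2 else 0

/-- `Σ_{i<j} Σ_{k<l} (Ω_{kl} Ω_{ij} g)²`. -/
def angsq2 (g : E3 → ℝ) (x : E3) : ℝ :=
  ∑ i, ∑ j, ∑ k, ∑ l, if i < j ∧ k < l then (ang k l (ang i j g) x) ^ 2 else 0

/-- The time derivative `∂_t u` of a space-time function. -/
def pdt (u : E3 × ℝ → ℝ) (p : E3 × ℝ) : ℝ := fderiv ℝ u p (0, 1)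

/-- The spatial slice `x ↦ u(x,t)` of a space-time function, at fixed time `t`. -/
def fixT (u : E3 × ℝ → ℝ) (t : ℝ) : E3 → ℝ := fun y => u (y, t)

/-- The spatial partial derivative `∂ᵢ u` of a space-time function (`t` fixed). -/
def pdx (i : Fin 3) (u : E3 × ℝ → ℝ) (p : E3 × ℝ) : ℝ := pd i (fixT u p.2) p.1

/-- The spatial radial derivative `∂_r u` of a space-time function (`t` fixed). -/
def pdrX (u : E3 × ℝ → ℝ) (p : E3 × ℝ) : ℝ := pdr (fixT u p.2) p.1

/-- The spatial angular derivative `Ω_{ij} u` of a space-time function (`t` fixed). -/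
def angX (i j : Fin 3) (u : E3 × ℝ → ℝ) (p : E3 × ℝ) : ℝ := ang i j (fixT u p.2) p.1

/-- The spatial operator `Ω u` of a space-time function (`t` fixed). -/
def angLapX (u : E3 × ℝ → ℝ) (p : E3 × ℝ) : ℝ := angLap (fixT u p.2) p.1

/-- The spatial Laplacian `Δu` of a space-time function (`t` fixed). -/
def lapX (u : E3 × ℝ → ℝ) (p : E3 × ℝ) : ℝ := lap (fixT u p.2) p.1

/-- The squared spatial gradient `|∇u|²` of a space-time function (`t` fixed). -/
def gradsqX (u : E3 × ℝ → ℝ) (p : E3 × ℝ) : ℝ := gradsq (fixT u p.2) p.1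

/-- `Σ_{i<j} (Ω_{ij} w)²` for a space-time function (`t` fixed). -/
def angsqX (w : E3 × ℝ → ℝ) (p : E3 × ℝ) : ℝ :=
  ∑ i, ∑ j, if i < j then (angX i j w p) ^ 2 else 0

/-- The solid light cone `t ≥ |x|`. -/
def cone : Set (E3 × ℝ) := {p | ‖p.1‖ ≤ p.2}

/-- `u` is a C² solution of the Goursat problem for `q` on the cone `t ≥ |x|`:
`∂_t²u − Δu − q u = 0` for `t > |x|` and `u(x,|x|) = ∫₀¹ q(σx) dσ`. -/
def GoursatSol (q : E3 → ℝ) (u : E3 × ℝ → ℝ) : Prop :=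
  ContDiffOn ℝ 2 u cone ∧
  (∀ p : E3 × ℝ, ‖p.1‖ < p.2 → pdt (pdt u) p - lapX u p - q p.1 * u p = 0) ∧
  (∀ x : E3, u (x, ‖x‖) = ∫ σ in (0:ℝ)..1, q (σ • x))

/-- `p(x) = ∫₀^{|x|} q(σ x/|x|) dσ`. -/
def pfun (q : E3 → ℝ) (x : E3) : ℝ := ∫ σ in (0:ℝ)..‖x‖, q ((σ / ‖x‖) • x)

/-- Integral over the sphere of radius `r` with respect to surface measure. -/
def sphInt (r : ℝ) (g : E3 → ℝ) : ℝ := ∫ x in sphere (0:E3) r, g x ∂μH[2]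

/-- Squared `L²` norm on the sphere of radius `r`. -/
def L2sq (g : E3 → ℝ) (r : ℝ) : ℝ := sphInt r (fun x => (g x) ^ 2)

/-- Squared `H¹` norm on the sphere of radius `r`. -/
def H1sq (g : E3 → ℝ) (r : ℝ) : ℝ := sphInt r (fun x => (g x) ^ 2 + (r ^ 2)⁻¹ * angsq g x)

/-- Squared `H²` norm on the sphere of radius `r`. -/
def H2sq (g : E3 → ℝ) (r : ℝ) : ℝ := H1sq g r + sphInt r (fun x => (r ^ 4)⁻¹ * angsq2 g x)

/-- The class `Q_γ(R,T)`. -/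
def memQ (R T γ : ℝ) (q : E3 → ℝ) : Prop :=
  ∀ r ∈ Icc R ((R + T) / 2),
    Real.sqrt (H2sq (pfun q) r) + Real.sqrt (H1sq (pdr (pfun q)) r) ≤
      γ * (Real.sqrt (H1sq (pfun q) r) + Real.sqrt (L2sq (pdr (pfun q)) r))

/-- The closed annulus `R ≤ |x| ≤ ρ` in `ℝ³`. -/
def Ann (R ρ : ℝ) : Set E3 := {x | R ≤ ‖x‖ ∧ ‖x‖ ≤ ρ}

/-- The space-time region `K_ρ = {R ≤ |x| ≤ ρ, |x| ≤ t ≤ R+T−|x|}`. -/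
def Kreg (R T ρ : ℝ) : Set (E3 × ℝ) :=
  {p | R ≤ ‖p.1‖ ∧ ‖p.1‖ ≤ ρ ∧ ‖p.1‖ ≤ p.2 ∧ p.2 ≤ R + T - ‖p.1‖}

/-- `F = ∂_t²w − ∂_r∂_r w − |x|^{-2} Ω w`. -/
def Fop (w : E3 × ℝ → ℝ) (p : E3 × ℝ) : ℝ :=
  pdt (pdt w) p - pdrX (pdrX w) p - (‖p.1‖ ^ 2)⁻¹ * angLapX w p

/-- The sideways energy `J(ρ)`. -/
def Jfun (R T : ℝ) (w : E3 × ℝ → ℝ) (ρ : ℝ) : ℝ :=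
  ∫ t in ρ..(R + T - ρ), sphInt ρ
    (fun x => (ρ ^ 2)⁻¹ * ((w (x, t)) ^ 2 + (pdt w (x, t)) ^ 2 + gradsqX w (x, t)))

section

/-- The open solid light cone `t > |x|`. -/
def openCone : Set (E3 × ℝ) := {p | ‖p.1‖ < p.2}

lemma isOpen_openCone : IsOpen openCone :=
  isOpen_lt (by fun_prop) (by fun_prop)

lemma isClosed_cone : IsClosed cone :=
  isClosed_le (by fun_prop) (by fun_prop)

lemma openCone_subset_cone : openCone ⊆ cone := fun _ hp => LT.lt.le (α := ℝ) hp

lemma cone_mem_nhds {p : E3 × ℝ} (hp : p ∈ openCone) : cone ∈ nhds p :=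
  Filter.mem_of_superset (isOpen_openCone.mem_nhds hp) openCone_subset_cone

lemma convex_cone : Convex ℝ cone := by
  intro p hp q hq a b ha hb _
  have hp' : ‖p.1‖ ≤ p.2 := hp
  have hq' : ‖q.1‖ ≤ q.2 := hq
  change ‖a • p.1 + b • q.1‖ ≤ a * p.2 + b * q.2
  refine (norm_add_le _ _).trans ?_
  rw [norm_smul, norm_smul, Real.norm_of_nonneg ha, Real.norm_of_nonneg hb]
  gcongr

lemma uniqueDiffOn_cone : UniqueDiffOn ℝ cone :=
  uniqueDiffOn_convex convex_cone
    ⟨((0 : E3), (1 : ℝ)), mem_interior_iff_mem_nhds.2 (cone_mem_nhds (by simp [openCone]))⟩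

/-- The second derivative of a space-time function as a bilinear form. -/
def hess (u : E3 × ℝ → ℝ) (p v w : E3 × ℝ) : ℝ := fderiv ℝ (fderiv ℝ u) p v w

variable {u : E3 × ℝ → ℝ} {p : E3 × ℝ}

lemma contDiffAt_of_cone (hu : ContDiffOn ℝ 2 u cone) {p : E3 × ℝ} (hp : p ∈ openCone) :
    ContDiffAt ℝ 2 u p :=
  hu.contDiffAt (cone_mem_nhds hp)

lemma ContDiffAt.differentiableAt_fderiv_two {E F : Type*} [NormedAddCommGroup E] [NormedSpace ℝ E]
    [NormedAddCommGroup F] [NormedSpace ℝ F] {f : E → F} {p : E} (h : ContDiffAt ℝ 2 f p) :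
    DifferentiableAt ℝ (fderiv ℝ f) p :=
  (h.fderiv_right (m := 1) (by norm_num)).differentiableAt (by norm_num)

lemma hasFDerivAt_fderiv_apply (h : ContDiffAt ℝ 2 u p) (v : E3 × ℝ) :
    HasFDerivAt (fun z => fderiv ℝ u z v) ((fderiv ℝ (fderiv ℝ u) p).flip v) p := by
  have := h.differentiableAt_fderiv_two.hasFDerivAt.clm_apply (hasFDerivAt_const v p)
  simpa using this

lemma hess_comm (h : ContDiffAt ℝ 2 u p) (v w : E3 × ℝ) : hess u p v w = hess u p w v :=
  (h.isSymmSndFDerivAt (by simp)) v w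

lemma pdt_pdt_eq (h : ContDiffAt ℝ 2 u p) : pdt (pdt u) p = hess u p (0, 1) (0, 1) := by
  have := (hasFDerivAt_fderiv_apply h ((0, 1) : E3 × ℝ)).fderiv
  change fderiv ℝ (fun z => fderiv ℝ u z (0, 1)) p (0, 1) = _
  rw [this]; rfl

lemma hasFDerivAt_fixT {t : ℝ} {x : E3} (h : DifferentiableAt ℝ u (x, t)) :
    HasFDerivAt (fixT u t) ((fderiv ℝ u (x, t)).comp (ContinuousLinearMap.inl ℝ E3 ℝ)) x := by
  have h1 : HasFDerivAt (fun y : E3 => (y, t)) (ContinuousLinearMap.inl ℝ E3 ℝ) x := by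
    exact hasFDerivAt_prodMk_left x t
  exact h.hasFDerivAt.comp x h1

lemma pd_fixT {t : ℝ} {x : E3} (h : DifferentiableAt ℝ u (x, t)) (i : Fin 3) :
    pd i (fixT u t) x = fderiv ℝ u (x, t) (basis3 i, 0) := by
  rw [pd, (hasFDerivAt_fixT h).fderiv]; simp

lemma lapX_eq (h : ContDiffAt ℝ 2 u p) :
    lapX u p = ∑ i, hess u p (basis3 i, 0) (basis3 i, 0) := by
  unfold lapX lap
  refine Finset.sum_congr rfl fun i _ => ?_
  have hev : pd i (fixT u p.2) =ᶠ[nhds p.1]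
      fixT (fun z => fderiv ℝ u z (basis3 i, 0)) p.2 := by
    have h2 : ∀ᶠ z in nhds p, ContDiffAt ℝ 2 u z := h.eventually (by simp)
    have h3 : Filter.Tendsto (fun y : E3 => (y, p.2)) (nhds p.1) (nhds p) :=
      Continuous.tendsto (f := fun y : E3 => (y, p.2)) (by fun_prop) p.1
    filter_upwards [h3.eventually h2] with y hy
    exact pd_fixT (hy.differentiableAt (by norm_num)) i
  have h4 := hasFDerivAt_fderiv_apply h ((basis3 i, 0) : E3 × ℝ)
  rw [pd, hev.fderiv_eq, ← pd, pd_fixT h4.differentiableAt, h4.fderiv]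
  rfl

lemma map_inl_eq_sum (L : E3 × ℝ →L[ℝ] ℝ) (x : E3) :
    L (x, 0) = ∑ i, x i * L (basis3 i, 0) := by
  have : ((x, 0) : E3 × ℝ) = ∑ i, x i • ((basis3 i, 0) : E3 × ℝ) := by
    ext j
    · simp [basis3, Fin.sum_univ_three]
      fin_cases j <;> simp
    · simp [Prod.snd_sum]
  rw [this, map_sum]
  refine Finset.sum_congr rfl fun i _ => ?_
  rw [map_smul, smul_eq_mul]

lemma pdrX_eq {p : E3 × ℝ} (h : DifferentiableAt ℝ u p) :
    pdrX u p = ‖p.1‖⁻¹ * fderiv ℝ u p (p.1, 0) := by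
  unfold pdrX pdr
  rw [map_inl_eq_sum]
  congr 1
  refine Finset.sum_congr rfl fun i _ => ?_
  rw [pd_fixT h]

lemma continuousOn_fderivWithin_cone (hu : ContDiffOn ℝ 2 u cone) :
    ContinuousOn (fderivWithin ℝ u cone) cone :=
  hu.continuousOn_fderivWithin uniqueDiffOn_cone (by norm_num)

lemma fderivWithin_cone {p : E3 × ℝ} (hp : p ∈ openCone) :
    fderivWithin ℝ u cone p = fderiv ℝ u p :=
  fderivWithin_of_mem_nhds (cone_mem_nhds hp)

/-- The part of the solid cone below time `T`. -/
def coneUpTo (T : ℝ) : Set (E3 × ℝ) := cone ∩ {p | p.2 ≤ T}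

lemma isCompact_coneUpTo (T : ℝ) : IsCompact (coneUpTo T) := by
  refine IsCompact.of_isClosed_subset ((isCompact_closedBall (0 : E3) T).prod (isCompact_Icc (a := 0) (b := T)))
    (isClosed_cone.inter (isClosed_le (by fun_prop) (by fun_prop))) ?_
  rintro ⟨x, t⟩ ⟨h1, h2⟩
  have h1' : ‖x‖ ≤ t := h1
  have h2' : t ≤ T := h2
  exact ⟨by simpa using h1'.trans h2', (norm_nonneg x).trans h1', h2'⟩

end

/-- A function vanishing at the left end whose derivative is at most `K e^{λ s}` in absolute value is
at most `K/2 e^{λ s}` there as soon as `λ ≥ 2 * C`, where the derivative is at most `C K e^{λ s}`. -/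
lemma abs_le_half_exp {f f' : ℝ → ℝ} {R r K C lam : ℝ} (hRr : R ≤ r) (hK : 0 ≤ K)
    (hC : 2 * C ≤ lam)
    (hf : ∀ s, R ≤ s → s ≤ r → HasDerivAt f (f' s) s) (h0 : f R = 0)
    (hf' : ∀ s, R ≤ s → s ≤ r → |f' s| ≤ C * K * exp (lam * s)) :
    |f r| ≤ K / 2 * exp (lam * r) := by
  have hder : ∀ s, HasDerivAt (fun s => K / 2 * exp (lam * s)) (lam * (K / 2) * exp (lam * s)) s := by
    intro s
    have h1 : HasDerivAt (fun s => lam * s) lam s := by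
      simpa using (hasDerivAt_id s).const_mul lam
    refine (h1.exp.const_mul (K / 2)).congr_deriv ?_
    ring
  refine image_norm_le_of_norm_deriv_right_le_deriv_boundary (a := R) (b := r) (f := f) (f' := f')
    (B := fun s => K / 2 * exp (lam * s)) (B' := fun s => lam * (K / 2) * exp (lam * s))
    (fun s hs => (hf s hs.1 hs.2).continuousAt.continuousWithinAt)
    (fun s hs => (hf s hs.1 hs.2.le).hasDerivWithinAt) ?_ hder ?_ ⟨hRr, le_rfl⟩
  · simp only [h0, norm_zero]; positivity
  · intro s hs
    refine (hf' s hs.1 hs.2.le).trans ?_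
    have : C * K ≤ lam * (K / 2) := by nlinarith
    gcongr

/-- Uniqueness for the sideways Goursat problem in characteristic form, in one space dimension.
Here `a = (∂_r + ∂_t) V` and `b = (∂_r - ∂_t) V`; the source `g` is controlled by `V` and by the
derivative `Q` of the boundary values `V(r,r)`. -/
lemma sideways_unique {R T C : ℝ} (hC : 0 ≤ C) {V a b g : ℝ → ℝ → ℝ} {Q : ℝ → ℝ}
    (hbd : ∃ B, ∀ r t, R ≤ r → r < t → t + r ≤ R + T →
      |V r t| ≤ B ∧ |a r t| ≤ B ∧ |b r t| ≤ B)
    (hV : ∀ r t, R ≤ r → r < t → t + r ≤ R + T →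
      HasDerivAt (fun s => V s t) ((a r t + b r t) / 2) r)
    (hV' : ∀ r t, R ≤ r → r < t → t + r ≤ R + T →
      HasDerivAt (fun s => V s (t - r + s)) (a r t) r)
    (ha : ∀ r t, R ≤ r → r < t → t + r ≤ R + T →
      HasDerivAt (fun s => a s (t + r - s)) (g r t) r)
    (hb : ∀ r t, R ≤ r → r < t → t + r ≤ R + T →
      HasDerivAt (fun s => b s (t - r + s)) (g r t) r)
    (hg : ∀ r t, R ≤ r → r < t → t + r ≤ R + T → |g r t| ≤ C * (|V r t| + |Q r|))
    (h0 : ∀ t, R < t → t ≤ T → V R t = 0 ∧ a R t = 0 ∧ b R t = 0)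
    (hQ : Continuous Q)
    (hVc : ∀ r, R ≤ r → Filter.Tendsto (fun δ => V r (r + δ)) (nhdsWithin 0 (Ioi 0)) (nhds (V r r)))
    (hVQ : ∀ r r', R ≤ r → r ≤ r' → V r' r' - V r r = ∫ s in r..r', Q s) :
    (∀ r t, R ≤ r → r < t → t + r ≤ R + T → V r t = 0) ∧
      ∀ r, R ≤ r → r < (R + T) / 2 → Q r = 0 := by
  set lam : ℝ := 4 * C + 2 with hlam
  have hlam0 : 0 < lam := by positivity
  have hQK : ∀ K : ℝ, (∀ r t, R ≤ r → r < t → t + r ≤ R + T → |a r t| ≤ K * exp (lam * r)) →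
      0 ≤ K → ∀ r, R ≤ r → r < (R + T) / 2 → |Q r| ≤ K * exp (lam * r) := by
    intro K hK hK0 r hr hr2
    have hint : ∀ r', r ≤ r' → r' < (R + T) / 2 →
        |∫ s in r..r', Q s| ≤ K * exp (lam * r') * (r' - r) := by
      intro r' hr' hr'2
      rw [← hVQ r r' hr hr']
      have hlim := ((hVc r' (hr.trans hr')).sub (hVc r hr)).abs
      refine le_of_tendsto hlim ?_
      have hpos : 0 < (R + T) - 2 * r' := by linarith
      filter_upwards [Ioo_mem_nhdsGT hpos] with δ hδ
      have := (convex_Icc r r').norm_image_sub_le_of_norm_hasDerivWithin_le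
        (f := fun s => V s (s + δ)) (f' := fun s => a s (s + δ)) (C := K * exp (lam * r'))
        (fun s hs => ?_) (fun s hs => ?_) (left_mem_Icc.2 hr') (right_mem_Icc.2 hr')
      · rwa [Real.norm_eq_abs, Real.norm_eq_abs, abs_of_nonneg (sub_nonneg.2 hr')] at this
      · have h1 := hV' s (s + δ) (hr.trans hs.1) (by linarith [hδ.1]) (by linarith [hδ.2, hs.2])
        simpa [add_comm] using h1.hasDerivWithinAt
      · refine (hK s (s + δ) (hr.trans hs.1) (by linarith [hδ.1]) (by linarith [hδ.2, hs.2])).trans ?_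
        have := hs.2
        gcongr
    have hder : HasDerivAt (fun x => ∫ s in r..x, Q s) (Q r) r :=
      intervalIntegral.integral_hasDerivAt_right (hQ.intervalIntegrable _ _)
        (hQ.stronglyMeasurableAtFilter _ _) hQ.continuousAt
    have hslope := (hasDerivWithinAt_iff_tendsto_slope' (s := Ioi r) (by simp)).1
      hder.hasDerivWithinAt
    have hrhs : Filter.Tendsto (fun x => K * exp (lam * x)) (nhdsWithin r (Ioi r))
        (nhds (K * exp (lam * r))) :=
      (Continuous.tendsto (by fun_prop) r).mono_left nhdsWithin_le_nhds
    refine le_of_tendsto_of_tendsto hslope.abs hrhs ?_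
    filter_upwards [Ioo_mem_nhdsGT hr2] with x hx
    have hx0 : 0 < x - r := sub_pos.2 hx.1
    rw [slope_def_field, abs_div, abs_of_pos hx0, div_le_iff₀ hx0]
    simpa using hint x hx.1.le hx.2
  have hstep : ∀ K : ℝ, 0 ≤ K →
      (∀ r t, R ≤ r → r < t → t + r ≤ R + T → |V r t| ≤ K * exp (lam * r) ∧
        |a r t| ≤ K * exp (lam * r) ∧ |b r t| ≤ K * exp (lam * r)) →
      (∀ r t, R ≤ r → r < t → t + r ≤ R + T → |V r t| ≤ K / 2 * exp (lam * r) ∧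
        |a r t| ≤ K / 2 * exp (lam * r) ∧ |b r t| ≤ K / 2 * exp (lam * r)) := by
    intro K hK hb' r t hr hrt hrT
    have hq := hQK K (fun r t h1 h2 h3 => (hb' r t h1 h2 h3).2.1) hK
    have hgK : ∀ r t, R ≤ r → r < t → t + r ≤ R + T → |g r t| ≤ 2 * C * K * exp (lam * r) := by
      intro r t h1 h2 h3
      refine (hg r t h1 h2 h3).trans ?_
      have h4 := (hb' r t h1 h2 h3).1
      have h5 := hq r h1 (by linarith)
      nlinarith
    refine ⟨?_, ?_, ?_⟩
    · refine abs_le_half_exp (lam := lam) (C := 1) (f := fun s => V s t)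
        (f' := fun s => (a s t + b s t) / 2) hr hK (by linarith) ?_
        (h0 t (by linarith) (by linarith)).1 ?_
      · intro s h1 h2
        exact hV s t h1 (by linarith) (by linarith)
      · intro s h1 h2
        have h3 := (hb' s t h1 (by linarith) (by linarith)).2.1
        have h4 := (hb' s t h1 (by linarith) (by linarith)).2.2
        rw [abs_le] at *
        constructor <;> linarith [h3.1, h3.2, h4.1, h4.2]
    · have := abs_le_half_exp (lam := lam) (C := 2 * C) (f := fun s => a s (t + r - s))
        (f' := fun s => g s (t + r - s)) hr hK (by linarith) ?_ ?_ ?_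
      · simpa using this
      · intro s h1 h2
        simpa using ha s (t + r - s) h1 (by linarith) (by linarith)
      · exact (h0 _ (by linarith) (by linarith)).2.1
      · intro s h1 h2
        exact hgK s (t + r - s) h1 (by linarith) (by linarith)
    · have := abs_le_half_exp (lam := lam) (C := 2 * C) (f := fun s => b s (t - r + s))
        (f' := fun s => g s (t - r + s)) hr hK (by linarith) ?_ ?_ ?_
      · simpa using this
      · intro s h1 h2
        simpa using hb s (t - r + s) h1 (by linarith) (by linarith)
      · exact (h0 _ (by linarith) (by linarith)).2.2
      · intro s h1 h2
        exact hgK s (t - r + s) h1 (by linarith) (by linarith)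
  obtain ⟨B, hB⟩ := hbd
  set K₀ : ℝ := |B| * exp (-(lam * R)) with hK₀
  have hiter : ∀ n : ℕ, ∀ r t, R ≤ r → r < t → t + r ≤ R + T →
      |V r t| ≤ K₀ * (1 / 2) ^ n * exp (lam * r) ∧ |a r t| ≤ K₀ * (1 / 2) ^ n * exp (lam * r) ∧
        |b r t| ≤ K₀ * (1 / 2) ^ n * exp (lam * r) := by
    intro n
    induction n with
    | zero =>
      intro r t h1 h2 h3
      have h4 : B ≤ K₀ * (1 / 2) ^ 0 * exp (lam * r) := by
        have : 1 ≤ exp (-(lam * R)) * exp (lam * r) := by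
          rw [← Real.exp_add]
          apply Real.one_le_exp
          nlinarith
        rw [hK₀, pow_zero, mul_one, mul_assoc]
        exact (le_abs_self B).trans (le_mul_of_one_le_right (abs_nonneg B) this)
      have h5 := hB r t h1 h2 h3
      exact ⟨h5.1.trans h4, h5.2.1.trans h4, h5.2.2.trans h4⟩
    | succ n ih =>
      have := hstep _ (by positivity) ih
      intro r t h1 h2 h3
      convert this r t h1 h2 h3 using 3 <;> ring_nf
  have hlim : ∀ r, Filter.Tendsto (fun n : ℕ => K₀ * (1 / 2) ^ n * exp (lam * r)) Filter.atTop
      (nhds 0) := by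
    intro r
    simpa using ((tendsto_pow_atTop_nhds_zero_of_lt_one (by norm_num : (0:ℝ) ≤ 1 / 2)
      (by norm_num)).const_mul K₀).mul_const (exp (lam * r))
  constructor
  · intro r t h1 h2 h3
    exact abs_nonpos_iff.1 (ge_of_tendsto' (hlim r) fun n => (hiter n r t h1 h2 h3).1)
  · intro r h1 h2
    exact abs_nonpos_iff.1 (ge_of_tendsto' (hlim r) fun n =>
      hQK _ (fun r t h1 h2 h3 => (hiter n r t h1 h2 h3).2.1) (by positivity) r h1 h2)

lemma integral_fderiv_eq_zero {F : E3 × ℝ → ℝ} (hF : ContDiff ℝ 1 F) (hc : HasCompactSupport F)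
    (v : E3 × ℝ) :
    Integrable (fun p => fderiv ℝ F p v) ∧ ∫ p, fderiv ℝ F p v = 0 := by
  have hF' : Continuous (fun p => fderiv ℝ F p v) :=
    (hF.continuous_fderiv (by norm_num)).clm_apply continuous_const
  have hcF' : HasCompactSupport (fun p => fderiv ℝ F p v) := hc.fderiv_apply ℝ v
  have hint := hF'.integrable_of_hasCompactSupport hcF' (μ := volume)
  refine ⟨hint, ?_⟩
  have : (volume : Measure (E3 × ℝ)).IsAddHaarMeasure := by
    rw [Measure.volume_eq_prod]; infer_instance
  have := integral_mul_fderiv_eq_neg_fderiv_mul_of_integrable (μ := (volume : Measure (E3 × ℝ)))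
    (f := fun _ => (1 : ℝ)) (g := F) (v := v) (by simp) (by simpa using hint)
    (by simpa using hF.continuous.integrable_of_hasCompactSupport hc)
    (fun _ _ => by fun_prop) (fun _ _ => hF.differentiable (by norm_num) _)
  simpa using this

/-- The energy density of a space-time function with differential `L` and value `s`. -/
def eng (L : E3 × ℝ →L[ℝ] ℝ) (s : ℝ) : ℝ := L (0, 1) ^ 2 + ∑ i, L (basis3 i, 0) ^ 2 + s ^ 2

/-- The energy flux across the level sets of `t² - |x|²`, up to a constant factor. -/
def flux (p : E3 × ℝ) (L : E3 × ℝ →L[ℝ] ℝ) (s : ℝ) : ℝ :=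
  p.2 * eng L s + 2 * L (0, 1) * L (p.1, 0)

lemma flux_le {p : E3 × ℝ} (hp : p ∈ openCone) (L : E3 × ℝ →L[ℝ] ℝ) (s : ℝ) :
    flux p L s ≤ 2 * p.2 * eng L s := by
  have hp' : ‖p.1‖ < p.2 := hp
  have ht : 0 < p.2 := (norm_nonneg _).trans_lt hp'
  have hcs : L (p.1, 0) ^ 2 ≤ p.2 ^ 2 * ∑ i, L (basis3 i, 0) ^ 2 := by
    rw [map_inl_eq_sum]
    refine (Finset.sum_mul_sq_le_sq_mul_sq _ _ _).trans ?_
    have : ∑ i, p.1 i ^ 2 ≤ p.2 ^ 2 := by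
      rw [← EuclideanSpace.real_norm_sq_eq]
      exact pow_le_pow_left₀ (norm_nonneg _) hp'.le 2
    have h0 : (0:ℝ) ≤ ∑ i, L (basis3 i, 0) ^ 2 := Finset.sum_nonneg fun i _ => sq_nonneg _
    gcongr
  unfold flux eng
  set A := L (0, 1)
  set B := L (p.1, 0)
  set S := ∑ i, L (basis3 i, 0) ^ 2
  have h1 : 2 * A * B ≤ p.2 * A ^ 2 + p.2 * S := by
    have : p.2 * (2 * A * B) ≤ p.2 * (p.2 * A ^ 2 + p.2 * S) := by
      nlinarith [sq_nonneg (p.2 * A - B)]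
    exact le_of_mul_le_mul_left this ht
  nlinarith [sq_nonneg s]

section boundary

variable {w : E3 × ℝ → ℝ}

lemma eng_origin (hw : ContDiffOn ℝ 2 w cone) (h0 : ∀ x : E3, w (x, ‖x‖) = 0) :
    eng (fderivWithin ℝ w cone 0) (w 0) = 0 := by
  have hmem : (0 : E3 × ℝ) ∈ cone := by simp [cone]
  set L := fderivWithin ℝ w cone 0 with hL
  have hd : HasFDerivWithinAt w L cone 0 :=
    (hw.differentiableOn (by norm_num) 0 hmem).hasFDerivWithinAt
  have hray : ∀ y : E3, L (y, ‖y‖) = 0 := by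
    intro y
    have hc : HasDerivWithinAt (fun s : ℝ => s • ((y, ‖y‖) : E3 × ℝ)) (y, ‖y‖) (Ici 0) 0 := by
      simpa using ((hasDerivAt_id (0:ℝ)).smul_const ((y, ‖y‖) : E3 × ℝ)).hasDerivWithinAt
    have hmaps : MapsTo (fun s : ℝ => s • ((y, ‖y‖) : E3 × ℝ)) (Ici 0) cone := by
      intro s hs
      have hs' : 0 ≤ s := hs
      simp [cone, norm_smul, abs_of_nonneg hs']
    have hcomp := HasFDerivWithinAt.comp_hasDerivWithinAt (x := (0:ℝ)) (l := w) (l' := L)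
      (t := cone) (by simpa using hd) hc hmaps
    have hzero : HasDerivWithinAt (w ∘ fun s : ℝ => s • ((y, ‖y‖) : E3 × ℝ)) 0 (Ici 0) 0 := by
      refine (hasDerivWithinAt_const (0:ℝ) (Ici 0) (0:ℝ)).congr ?_ ?_
      · intro s hs
        have hs' : 0 ≤ s := hs
        have := h0 (s • y)
        simpa [norm_smul, abs_of_nonneg hs'] using this
      · simpa using h0 0
    exact (uniqueDiffWithinAt_Ici (0:ℝ)).eq_deriv _ hcomp hzero
  have hx : ∀ y : E3, ‖y‖ = 1 → L (0, 1) = 0 ∧ L (y, 0) = 0 := by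
    intro y hy
    have h1 := hray y
    have h2 := hray (-y)
    rw [norm_neg, hy] at h2
    rw [hy] at h1
    have e1 : ((y, 1) : E3 × ℝ) = (y, 0) + (0, 1) := by simp
    have e2 : ((-y, 1) : E3 × ℝ) = -(y, 0) + (0, 1) := by simp
    rw [e1, map_add] at h1
    rw [e2, map_add, map_neg] at h2
    constructor <;> linarith
  have hb : ∀ i, ‖basis3 i‖ = 1 := fun i => by simp [basis3]
  have hw0 : w 0 = 0 := by
    have := h0 0
    rwa [norm_zero] at this
  simp [eng, (hx _ (hb 0)).1, fun i => (hx _ (hb i)).2, hw0]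

lemma flux_boundary (hw : ContDiffOn ℝ 2 w cone) (h0 : ∀ x : E3, w (x, ‖x‖) = 0) (x : E3) :
    flux (x, ‖x‖) (fderivWithin ℝ w cone (x, ‖x‖)) (w (x, ‖x‖)) = 0 := by
  by_cases hx : x = 0
  · subst hx
    have := eng_origin hw h0
    have e : ((0, ‖(0:E3)‖) : E3 × ℝ) = 0 := by simp
    rw [e, flux, this]
    have e2 : (((0 : E3 × ℝ).1, 0) : E3 × ℝ) = 0 := rfl
    rw [e2]
    simp
  have hmem : ((x, ‖x‖) : E3 × ℝ) ∈ cone := by simp [cone]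
  set L := fderivWithin ℝ w cone (x, ‖x‖) with hL
  have hd : HasFDerivWithinAt w L cone (x, ‖x‖) :=
    (hw.differentiableOn (by norm_num) _ hmem).hasFDerivWithinAt
  have hxn : ‖x‖ ≠ 0 := norm_ne_zero_iff.2 hx
  have htan : ∀ i, L (basis3 i, 0) = -(x i / ‖x‖) * L (0, 1) := by
    intro i
    have hn : HasFDerivAt (fun y : E3 => ‖y‖) (‖x‖⁻¹ • innerSL ℝ x) x := by
      have h1 := ((hasStrictFDerivAt_norm_sq x).hasFDerivAt.sqrt (by positivity))
      have h2 : (fun y : E3 => √(‖y‖ ^ 2)) = fun y => ‖y‖ := by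
        funext y; exact Real.sqrt_sq (norm_nonneg y)
      rw [h2, Real.sqrt_sq (norm_nonneg x)] at h1
      refine h1.congr_fderiv ?_
      ext v
      simp
      field_simp
    have hg : HasFDerivAt (fun y : E3 => ((y, ‖y‖) : E3 × ℝ))
        ((ContinuousLinearMap.id ℝ E3).prod (‖x‖⁻¹ • innerSL ℝ x)) x :=
      (hasFDerivAt_id x).prodMk hn
    have hcomp := HasFDerivWithinAt.comp_hasFDerivAt (x := x) (t := cone) (g := w) (g' := L) hd hg
      (Filter.Eventually.of_forall fun y => by simp [cone])
    have hz : (w ∘ fun y : E3 => ((y, ‖y‖) : E3 × ℝ)) = fun _ => (0:ℝ) := funext h0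
    rw [hz] at hcomp
    have h3 := hcomp.unique (hasFDerivAt_const (0:ℝ) x)
    have h4 := congrArg (fun M : E3 →L[ℝ] ℝ => M (basis3 i)) h3
    have h5 : L (basis3 i, x i / ‖x‖) = 0 := by
      have h6 : ‖x‖⁻¹ * inner ℝ x (basis3 i) = x i / ‖x‖ := by
        simp [basis3, EuclideanSpace.inner_single_right]; ring
      simpa [h6] using h4
    have e : ((basis3 i, x i / ‖x‖) : E3 × ℝ) = (basis3 i, 0) + (x i / ‖x‖) • (0, 1) := by simp
    rw [e, map_add, map_smul, smul_eq_mul] at h5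
    linarith
  have hs : ∑ i, x i ^ 2 = ‖x‖ ^ 2 := (EuclideanSpace.real_norm_sq_eq x).symm
  have hsum1 : ∑ i, L (basis3 i, 0) ^ 2 = L (0, 1) ^ 2 := by
    simp_rw [htan]
    have : ∀ i, (-(x i / ‖x‖) * L (0, 1)) ^ 2 = x i ^ 2 * (L (0, 1) ^ 2 / ‖x‖ ^ 2) := by
      intro i; field_simp
    simp_rw [this]
    rw [← Finset.sum_mul, hs]
    field_simp
  have hsum2 : L (x, 0) = -‖x‖ * L (0, 1) := by
    rw [map_inl_eq_sum]
    simp_rw [htan]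
    have : ∀ i, x i * (-(x i / ‖x‖) * L (0, 1)) = x i ^ 2 * (-L (0, 1) / ‖x‖) := by
      intro i; field_simp
    simp_rw [this]
    rw [← Finset.sum_mul, hs]
    field_simp
  simp only [flux, eng, hsum1, hsum2, h0]
  ring

end boundary

lemma deriv_smoothTransition_nonneg (s : ℝ) : 0 ≤ deriv smoothTransition s :=
  Real.smoothTransition.monotone.deriv_nonneg

lemma deriv_smoothTransition_of_one_lt {s : ℝ} (hs : 1 < s) : deriv smoothTransition s = 0 := by
  have : smoothTransition =ᶠ[nhds s] fun _ => (1 : ℝ) := by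
    filter_upwards [Ioi_mem_nhds hs] with x hx
    exact Real.smoothTransition.one_of_one_le (le_of_lt hx)
  rw [this.deriv_eq, deriv_const]

lemma hasDerivAt_smoothTransition (s : ℝ) :
    HasDerivAt smoothTransition (deriv smoothTransition s) s :=
  ((Real.smoothTransition.contDiff (n := 1)).differentiable (by norm_num) s).hasDerivAt

/-- A decreasing time weight vanishing for `t ≥ T`. -/
def timeWeight (lam T t : ℝ) : ℝ := exp (-(lam * t)) * smoothTransition (T - t)

/-- The derivative of `timeWeight`. -/
def timeWeight' (lam T t : ℝ) : ℝ :=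
  -(lam * timeWeight lam T t) - exp (-(lam * t)) * deriv smoothTransition (T - t)

lemma hasDerivAt_timeWeight (lam T t : ℝ) :
    HasDerivAt (timeWeight lam T) (timeWeight' lam T t) t := by
  have h1 : HasDerivAt (fun t => exp (-(lam * t))) (exp (-(lam * t)) * (-lam)) t := by
    have : HasDerivAt (fun t => -(lam * t)) (-lam) t := by
      simpa using ((hasDerivAt_id t).const_mul lam).fun_neg
    exact this.exp
  have h2 : HasDerivAt (fun t => smoothTransition (T - t)) (-deriv smoothTransition (T - t)) t := by
    have h : HasDerivAt (fun s => smoothTransition (T - s)) _ t :=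
      (hasDerivAt_smoothTransition (T - t)).comp t ((hasDerivAt_id t).const_sub T)
    exact h.congr_deriv (by simp)
  refine (h1.mul h2).congr_deriv ?_
  unfold timeWeight' timeWeight
  ring

lemma timeWeight_nonneg (lam T t : ℝ) : 0 ≤ timeWeight lam T t :=
  mul_nonneg (exp_pos _).le (Real.smoothTransition.nonneg _)

lemma timeWeight'_le (lam T t : ℝ) : timeWeight' lam T t ≤ -(lam * timeWeight lam T t) := by
  have := mul_nonneg (exp_pos (-(lam * t))).le (deriv_smoothTransition_nonneg (T - t))
  unfold timeWeight'
  linarith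

lemma contDiff_timeWeight (lam T : ℝ) : ContDiff ℝ 1 (timeWeight lam T) := by
  unfold timeWeight
  have := Real.smoothTransition.contDiff (n := 1)
  fun_prop

lemma continuous_timeWeight' (lam T : ℝ) : Continuous (timeWeight' lam T) := by
  have : timeWeight' lam T = deriv (timeWeight lam T) :=
    funext fun t => (hasDerivAt_timeWeight lam T t).deriv.symm
  rw [this]
  exact (contDiff_timeWeight lam T).continuous_deriv (by norm_num)

/-- A defining function of the solid cone: it is positive exactly in the open cone. -/
def coneFun (p : E3 × ℝ) : ℝ := p.2 * |p.2| - ‖p.1‖ ^ 2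

lemma continuous_coneFun : Continuous coneFun := by unfold coneFun; fun_prop

lemma coneFun_pos_iff {p : E3 × ℝ} : 0 < coneFun p ↔ p ∈ openCone := by
  change 0 < p.2 * |p.2| - ‖p.1‖ ^ 2 ↔ ‖p.1‖ < p.2
  have h := norm_nonneg p.1
  rcases le_or_gt p.2 0 with ht | ht
  · rw [abs_of_nonpos ht]
    constructor
    · intro h1; nlinarith
    · intro h1; linarith
  · rw [abs_of_pos ht]
    constructor
    · intro h1; nlinarith
    · intro h1; nlinarith

/-- The space-time cutoff: a time weight times a cutoff to the interior of the cone. -/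
def cutoff (lam T ε : ℝ) (p : E3 × ℝ) : ℝ :=
  timeWeight lam T p.2 * smoothTransition (coneFun p / ε - 1)

lemma cutoff_nonneg (lam T ε : ℝ) (p : E3 × ℝ) : 0 ≤ cutoff lam T ε p :=
  mul_nonneg (timeWeight_nonneg _ _ _) (Real.smoothTransition.nonneg _)

lemma cutoff_eq_zero {lam T ε : ℝ} (hε : 0 < ε) {p : E3 × ℝ} (hp : coneFun p ≤ ε) :
    cutoff lam T ε p = 0 := by
  have : coneFun p / ε - 1 ≤ 0 := by rw [sub_nonpos, div_le_one hε]; exact hp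
  rw [cutoff, Real.smoothTransition.zero_of_nonpos this, mul_zero]

lemma cutoff_eq_zero_of_le {lam T ε : ℝ} {p : E3 × ℝ} (hp : T ≤ p.2) : cutoff lam T ε p = 0 := by
  rw [cutoff, timeWeight, Real.smoothTransition.zero_of_nonpos (by linarith), mul_zero, zero_mul]

lemma cutoff_mono {lam T ε ε' : ℝ} (hε : 0 < ε) (h : ε ≤ ε') (p : E3 × ℝ) :
    cutoff lam T ε' p ≤ cutoff lam T ε p := by
  rcases le_or_gt (coneFun p) 0 with hp | hp
  · rw [cutoff_eq_zero (hε.trans_le h) (hp.trans (hε.trans_le h).le)]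
    exact cutoff_nonneg _ _ _ _
  · refine mul_le_mul_of_nonneg_left (Real.smoothTransition.monotone ?_) (timeWeight_nonneg _ _ _)
    gcongr

lemma hasFDerivAt_coneFun {p : E3 × ℝ} (hp : p ∈ openCone) :
    HasFDerivAt coneFun ((2 * p.2) • ContinuousLinearMap.snd ℝ E3 ℝ -
      2 • (innerSL ℝ p.1).comp (ContinuousLinearMap.fst ℝ E3 ℝ)) p := by
  have ht : 0 < p.2 := (norm_nonneg _).trans_lt hp
  have hev : coneFun =ᶠ[nhds p] fun z => z.2 ^ 2 - ‖z.1‖ ^ 2 := by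
    have : ∀ᶠ z : E3 × ℝ in nhds p, 0 < z.2 := continuous_snd.continuousAt.eventually (lt_mem_nhds ht)
    filter_upwards [this] with z hz
    rw [coneFun, abs_of_pos hz]; ring
  refine HasFDerivAt.congr_of_eventuallyEq ?_ hev
  have h1 : HasFDerivAt (fun z : E3 × ℝ => z.2 ^ 2) ((2 * p.2) • ContinuousLinearMap.snd ℝ E3 ℝ) p := by
    refine ((hasFDerivAt_snd (p := p)).pow 2).congr_fderiv ?_
    ext v <;> simp
  have h2 : HasFDerivAt (fun z : E3 × ℝ => ‖z.1‖ ^ 2)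
      (2 • (innerSL ℝ p.1).comp (ContinuousLinearMap.fst ℝ E3 ℝ)) p :=
    ((hasStrictFDerivAt_norm_sq p.1).hasFDerivAt.comp p (hasFDerivAt_fst (p := p)))
  exact h1.sub h2

lemma contDiffAt_cutoff {lam T ε : ℝ} {p : E3 × ℝ} (hp : p ∈ openCone) :
    ContDiffAt ℝ 1 (cutoff lam T ε) p := by
  have ht : 0 < p.2 := (norm_nonneg _).trans_lt hp
  have hev : coneFun =ᶠ[nhds p] fun z => z.2 ^ 2 - ‖z.1‖ ^ 2 := by
    have : ∀ᶠ z : E3 × ℝ in nhds p, 0 < z.2 := continuous_snd.continuousAt.eventually (lt_mem_nhds ht)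
    filter_upwards [this] with z hz
    rw [coneFun, abs_of_pos hz]; ring
  have h1 : ContDiffAt ℝ 1 coneFun p := by
    refine ContDiffAt.congr_of_eventuallyEq ?_ hev
    exact (ContDiff.sub (contDiff_snd.pow 2) (contDiff_fst.norm_sq ℝ)).contDiffAt
  have h2 : ContDiffAt ℝ 1 (fun z => smoothTransition (coneFun z / ε - 1)) p :=
    (Real.smoothTransition.contDiff (n := 1)).contDiffAt.comp p
      ((h1.div_const ε).sub contDiffAt_const)
  exact ((contDiff_timeWeight lam T).contDiffAt.comp p contDiffAt_snd).mul h2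

lemma fderiv_cutoff {lam T ε : ℝ} {p : E3 × ℝ} (hp : p ∈ openCone) (v : E3 × ℝ) :
    fderiv ℝ (cutoff lam T ε) p v =
      timeWeight' lam T p.2 * v.2 * smoothTransition (coneFun p / ε - 1) +
      timeWeight lam T p.2 * (deriv smoothTransition (coneFun p / ε - 1) *
        ((2 * p.2 * v.2 - 2 * inner ℝ p.1 v.1) / ε)) := by
  have hs : HasFDerivAt (fun z : E3 × ℝ => z.2) (ContinuousLinearMap.snd ℝ E3 ℝ) p := hasFDerivAt_snd
  have h1 := (hasDerivAt_timeWeight lam T p.2).comp_hasFDerivAt p hs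
  have h2 := (hasDerivAt_smoothTransition (coneFun p / ε - 1)).comp_hasFDerivAt p
    (((hasFDerivAt_coneFun hp).mul_const ε⁻¹).sub_const 1)
  have h3 := h1.mul h2
  have h4 : HasFDerivAt (cutoff lam T ε) _ p := h3
  rw [h4.fderiv]
  simp only [Function.comp, _root_.add_apply, _root_.smul_apply,
    _root_.sub_apply, ContinuousLinearMap.comp_apply, ContinuousLinearMap.coe_fst',
    ContinuousLinearMap.coe_snd', innerSL_apply_apply, smul_eq_mul, nsmul_eq_mul, div_eq_mul_inv]
  push_cast
  ring

lemma cutoff_mul_contDiff {lam T ε : ℝ} (hε : 0 < ε) {g : E3 × ℝ → ℝ}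
    (hg : ∀ p ∈ openCone, ContDiffAt ℝ 1 g p) :
    ContDiff ℝ 1 (fun p => cutoff lam T ε p * g p) ∧
      HasCompactSupport (fun p => cutoff lam T ε p * g p) ∧
      ∀ p ∉ openCone, ∀ v, fderiv ℝ (fun p => cutoff lam T ε p * g p) p v = 0 := by
  have hev : ∀ p ∉ openCone, (fun p => cutoff lam T ε p * g p) =ᶠ[nhds p] fun _ => 0 := by
    intro p hp
    have h1 : coneFun p < ε := (not_lt.1 (mt coneFun_pos_iff.1 hp)).trans_lt hε
    have h2 : ∀ᶠ z in nhds p, coneFun z < ε := continuous_coneFun.continuousAt.eventually (gt_mem_nhds h1)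
    filter_upwards [h2] with z hz
    rw [cutoff_eq_zero hε hz.le, zero_mul]
  refine ⟨?_, ?_, ?_⟩
  · rw [contDiff_iff_contDiffAt]
    intro p
    by_cases hp : p ∈ openCone
    · exact (contDiffAt_cutoff hp).mul (hg p hp)
    · exact contDiffAt_const.congr_of_eventuallyEq (hev p hp)
  · refine HasCompactSupport.intro (isCompact_coneUpTo T) fun p hp => ?_
    by_cases hp1 : p ∈ openCone
    · have : ¬ p.2 ≤ T := fun h => hp ⟨openCone_subset_cone hp1, h⟩
      rw [cutoff_eq_zero_of_le (not_le.1 this).le, zero_mul]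
    · exact (hev p hp1).self_of_nhds
  · intro p hp v
    rw [(hev p hp).fderiv_eq]
    simp

lemma deriv_smoothTransition_of_neg {s : ℝ} (hs : s < 0) : deriv smoothTransition s = 0 := by
  have : smoothTransition =ᶠ[nhds s] fun _ => (0 : ℝ) := by
    filter_upwards [Iio_mem_nhds hs] with x hx
    exact Real.smoothTransition.zero_of_nonpos (le_of_lt hx)
  rw [this.deriv_eq, deriv_const]

lemma timeWeight'_bound (lam T : ℝ) : ∃ M, 0 ≤ M ∧ ∀ t, 0 ≤ t → |timeWeight' lam T t| ≤ M := by
  obtain ⟨M, hM⟩ := (isCompact_Icc (a := (0:ℝ)) (b := T)).exists_bound_of_continuousOn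
    (continuous_timeWeight' lam T).continuousOn
  refine ⟨max M 0, le_max_right _ _, fun t ht => ?_⟩
  rcases le_or_gt t T with h | h
  · exact (hM t ⟨ht, h⟩).trans (le_max_left _ _)
  · rw [timeWeight', timeWeight, Real.smoothTransition.zero_of_nonpos (by linarith),
      deriv_smoothTransition_of_neg (by linarith)]
    simp

section energy

variable {w : E3 × ℝ → ℝ}

/-- The energy density of `w`. -/
def engOf (w : E3 × ℝ → ℝ) (p : E3 × ℝ) : ℝ := eng (fderiv ℝ w p) (w p)

lemma engOf_nonneg (p : E3 × ℝ) : 0 ≤ engOf w p := by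
  unfold engOf eng
  positivity

lemma hasFDerivAt_engOf {p : E3 × ℝ} (h : ContDiffAt ℝ 2 w p) (v : E3 × ℝ) :
    DifferentiableAt ℝ (engOf w) p ∧
    fderiv ℝ (engOf w) p v = 2 * fderiv ℝ w p (0, 1) * hess w p v (0, 1) +
      (∑ i, 2 * fderiv ℝ w p (basis3 i, 0) * hess w p v (basis3 i, 0)) +
      2 * w p * fderiv ℝ w p v := by
  have hF := (((hasFDerivAt_fderiv_apply h (0, 1)).pow 2).add
    (HasFDerivAt.fun_sum (u := Finset.univ) fun (i : Fin 3) _ =>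
      (hasFDerivAt_fderiv_apply h (basis3 i, 0)).pow 2)).add
    ((h.differentiableAt (by norm_num)).hasFDerivAt.pow 2)
  have hF' : HasFDerivAt (engOf w) _ p := hF
  refine ⟨hF'.differentiableAt, ?_⟩
  rw [hF'.fderiv]
  simp [hess, Fin.sum_univ_three]

lemma contDiffAt_fderiv_apply {p : E3 × ℝ} (h : ContDiffAt ℝ 2 w p) (v : E3 × ℝ) :
    ContDiffAt ℝ 1 (fun z => fderiv ℝ w z v) p :=
  (h.fderiv_right (m := 1) (by norm_num)).clm_apply contDiffAt_const

lemma contDiffAt_engOf {p : E3 × ℝ} (h : ContDiffAt ℝ 2 w p) : ContDiffAt ℝ 1 (engOf w) p :=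
  (((contDiffAt_fderiv_apply h _).pow 2).add
    (ContDiffAt.sum fun _ _ => (contDiffAt_fderiv_apply h _).pow 2)).add
    ((h.of_le (by norm_num)).pow 2)

/-- The spatial component of the energy current. -/
def current (w : E3 × ℝ → ℝ) (i : Fin 3) (p : E3 × ℝ) : ℝ :=
  -(2 * (fderiv ℝ w p (0, 1) * fderiv ℝ w p (basis3 i, 0)))

lemma contDiffAt_current {p : E3 × ℝ} (h : ContDiffAt ℝ 2 w p) (i : Fin 3) :
    ContDiffAt ℝ 1 (current w i) p :=
  (contDiffAt_const.mul ((contDiffAt_fderiv_apply h _).mul (contDiffAt_fderiv_apply h _))).neg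

lemma fderiv_current {p : E3 × ℝ} (h : ContDiffAt ℝ 2 w p) (i : Fin 3) (v : E3 × ℝ) :
    fderiv ℝ (current w i) p v = -(2 * (fderiv ℝ w p (0, 1) * hess w p v (basis3 i, 0) +
      fderiv ℝ w p (basis3 i, 0) * hess w p v (0, 1))) := by
  have hF := (((hasFDerivAt_fderiv_apply h (0, 1)).mul
    (hasFDerivAt_fderiv_apply h (basis3 i, 0))).const_mul 2).neg
  have hF' : HasFDerivAt (current w i) _ p := hF
  rw [hF'.fderiv]
  simp [hess]
  ring

lemma sum_fderiv_current {p : E3 × ℝ} {c : E3 → ℝ} (h : ContDiffAt ℝ 2 w p)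
    (heq : hess w p (0, 1) (0, 1) - ∑ i, hess w p (basis3 i, 0) (basis3 i, 0) = c p.1 * w p) :
    fderiv ℝ (engOf w) p (0, 1) + ∑ i, fderiv ℝ (current w i) p (basis3 i, 0) =
      2 * (1 + c p.1) * (w p * fderiv ℝ w p (0, 1)) := by
  rw [(hasFDerivAt_engOf h _).2]
  simp only [fderiv_current h, Fin.sum_univ_three, hess_comm h (basis3 _, 0) (0, 1)] at heq ⊢
  linear_combination 2 * fderiv ℝ w p (0, 1) * heq

/-- The divergence identity for the energy current multiplied by the cutoff. -/
lemma divergence_cutoff {p : E3 × ℝ} {c : E3 → ℝ} {lam T ε : ℝ} (hp : p ∈ openCone)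
    (h : ContDiffAt ℝ 2 w p)
    (heq : hess w p (0, 1) (0, 1) - ∑ i, hess w p (basis3 i, 0) (basis3 i, 0) = c p.1 * w p) :
    fderiv ℝ (fun z => cutoff lam T ε z * engOf w z) p (0, 1) +
      ∑ i, fderiv ℝ (fun z => cutoff lam T ε z * current w i z) p (basis3 i, 0) =
    cutoff lam T ε p * (2 * (1 + c p.1) * (w p * fderiv ℝ w p (0, 1))) +
      timeWeight' lam T p.2 * smoothTransition (coneFun p / ε - 1) * engOf w p +
      2 / ε * timeWeight lam T p.2 * deriv smoothTransition (coneFun p / ε - 1) *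
        flux p (fderiv ℝ w p) (w p) := by
  have hψ := (contDiffAt_cutoff (lam := lam) (T := T) (ε := ε) hp).differentiableAt (by norm_num)
  have h1 : ∀ g : E3 × ℝ → ℝ, ContDiffAt ℝ 1 g p → ∀ v,
      fderiv ℝ (fun z => cutoff lam T ε z * g z) p v =
        cutoff lam T ε p * fderiv ℝ g p v + g p * fderiv ℝ (cutoff lam T ε) p v := by
    intro g hg v
    rw [fderiv_fun_mul hψ (hg.differentiableAt (by norm_num))]
    simp
  rw [h1 _ (contDiffAt_engOf h)]
  simp only [h1 _ (contDiffAt_current h _), fderiv_cutoff hp]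
  rw [← sum_fderiv_current h heq, flux, map_inl_eq_sum]
  have hin : ∀ i, inner ℝ p.1 (basis3 i) = p.1 i := by
    intro i; simp [basis3, EuclideanSpace.inner_single_right]
  simp only [hin, inner_zero_right, Fin.sum_univ_three, current,
    show eng (fderiv ℝ w p) (w p) = engOf w p from rfl]
  ring


lemma exists_flux_le (hw : ContDiffOn ℝ 2 w cone) (h0 : ∀ x : E3, w (x, ‖x‖) = 0) (T : ℝ)
    {η : ℝ} (hη : 0 < η) :
    ∃ N > 0, ∀ p ∈ openCone, p.2 ≤ T → coneFun p < N →
      flux p (fderiv ℝ w p) (w p) ≤ η * p.2 := by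
  have hL := continuousOn_fderivWithin_cone hw
  have hap : ∀ v : E3 × ℝ, ContinuousOn (fun p => fderivWithin ℝ w cone p v) cone :=
    fun v => hL.clm_apply continuousOn_const
  have hL1 : ContinuousOn (fun p => eng (fderivWithin ℝ w cone p) (w p)) cone :=
    (((hap _).pow 2).add (continuousOn_finsetSum _ fun _ _ => (hap _).pow 2)).add
      (hw.continuousOn.pow 2)
  have hL2 : ContinuousOn (fun p => flux p (fderivWithin ℝ w cone p) (w p)) cone :=
    (continuous_snd.continuousOn.mul hL1).add ((continuousOn_const.mul (hap _)).mul
      (hL.clm_apply (Continuous.continuousOn (by fun_prop))))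
  set S : Set (E3 × ℝ) := coneUpTo T ∩ {p | η * p.2 ≤ flux p (fderivWithin ℝ w cone p) (w p) ∧
    η / 2 ≤ eng (fderivWithin ℝ w cone p) (w p)} with hS
  have hScl : IsClosed S := by
    have hsub : coneUpTo T ⊆ cone := inter_subset_left
    have hcl := (isCompact_coneUpTo T).isClosed
    have e : S = (coneUpTo T ∩ {p | η * p.2 ≤ flux p (fderivWithin ℝ w cone p) (w p)}) ∩
        (coneUpTo T ∩ {p | η / 2 ≤ eng (fderivWithin ℝ w cone p) (w p)}) := by
      rw [hS]; ext p; simp only [mem_inter_iff, mem_ofPred_eq]; tauto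
    rw [e]
    exact (hcl.isClosed_le (Continuous.continuousOn (by fun_prop)) (hL2.mono hsub)).inter
      (hcl.isClosed_le continuousOn_const (hL1.mono hsub))
  have hSc : IsCompact S := (isCompact_coneUpTo T).of_isClosed_subset hScl inter_subset_left
  have hpos : ∀ p ∈ S, 0 < coneFun p := by
    rintro ⟨x, t⟩ ⟨⟨h1, -⟩, h2, h3⟩
    rw [coneFun_pos_iff]
    refine lt_of_le_of_ne (show ‖x‖ ≤ t from h1) fun h => ?_
    have h' : t = ‖x‖ := h.symm
    subst h'
    rw [flux_boundary hw h0] at h2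
    have hx : ‖x‖ = 0 := le_antisymm (nonpos_of_mul_nonpos_right h2 hη) (norm_nonneg x)
    have e : ((x, ‖x‖) : E3 × ℝ) = 0 := by rw [hx, norm_eq_zero.1 hx]; rfl
    rw [e, eng_origin hw h0] at h3
    linarith
  obtain ⟨N, hN, hN'⟩ := hSc.exists_forall_le' continuous_coneFun.continuousOn hpos
  refine ⟨N, hN, fun p hp hpT hpN => ?_⟩
  by_contra! hlt
  have hle := flux_le hp (fderiv ℝ w p) (w p)
  have ht : 0 < p.2 := (norm_nonneg _).trans_lt hp
  refine hpN.not_ge (hN' p ⟨⟨openCone_subset_cone hp, hpT⟩, ?_⟩)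
  rw [mem_ofPred_eq, fderivWithin_cone hp]
  refine ⟨hlt.le, le_of_mul_le_mul_left (a := 2 * p.2) ?_ (by positivity)⟩
  linarith

/-- Pointwise form of the energy estimate. -/
lemma cutoff_energy_le {p : E3 × ℝ} {c : E3 → ℝ} {C T ε η M : ℝ} (hp : p ∈ openCone)
    (h : ContDiffAt ℝ 2 w p)
    (heq : hess w p (0, 1) (0, 1) - ∑ i, hess w p (basis3 i, 0) (basis3 i, 0) = c p.1 * w p)
    (hC : p.2 ≤ T → 1 + |c p.1| ≤ C) (hε : 0 < ε) (hη : 0 < η)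
    (hM : |timeWeight' (C + 1) T p.2| ≤ M)
    (hfl : p.2 ≤ T → coneFun p ≤ 2 * ε → flux p (fderiv ℝ w p) (w p) ≤ η * p.2) :
    cutoff (C + 1) T ε p * engOf w p ≤
      -(fderiv ℝ (fun z => cutoff (C + 1) T ε z * engOf w z) p (0, 1) +
      ∑ i, fderiv ℝ (fun z => cutoff (C + 1) T ε z * current w i z) p (basis3 i, 0) -
      η * fderiv ℝ (fun z => cutoff (C + 1) T ε z * 1) p (0, 1)) + η * M := by
  simp only [mul_one]
  rw [divergence_cutoff hp h heq, fderiv_cutoff hp]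
  have hM0 := (abs_nonneg _).trans hM
  have hφ0 := Real.smoothTransition.nonneg (coneFun p / ε - 1)
  have hφ1 := Real.smoothTransition.le_one (coneFun p / ε - 1)
  have hφd := deriv_smoothTransition_nonneg (coneFun p / ε - 1)
  have hdz : ¬ coneFun p ≤ 2 * ε → deriv smoothTransition (coneFun p / ε - 1) = 0 := by
    intro hn
    refine deriv_smoothTransition_of_one_lt ?_
    rw [lt_sub_iff_add_lt, lt_div_iff₀ hε]
    linarith
  have htw := timeWeight_nonneg (C + 1) T p.2
  have htw' := timeWeight'_le (C + 1) T p.2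
  have he := engOf_nonneg (w := w) p
  have hww : |w p * fderiv ℝ w p (0, 1)| * 2 ≤ engOf w p := by
    have hs : 0 ≤ ∑ i, fderiv ℝ w p (basis3 i, 0) ^ 2 := Finset.sum_nonneg fun _ _ => sq_nonneg _
    unfold engOf eng
    rw [abs_mul]
    nlinarith [sq_abs (w p), sq_abs (fderiv ℝ w p (0, 1)),
      sq_nonneg (|w p| - |fderiv ℝ w p (0, 1)|)]
  rw [inner_zero_right]
  set φ := smoothTransition (coneFun p / ε - 1)
  set φ' := deriv smoothTransition (coneFun p / ε - 1)
  set τ := timeWeight (C + 1) T p.2 with hτ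
  set τ' := timeWeight' (C + 1) T p.2
  set F := flux p (fderiv ℝ w p) (w p)
  have hcut : cutoff (C + 1) T ε p = τ * φ := rfl
  rw [hcut]
  have hτ0 : ¬ p.2 ≤ T → τ = 0 := by
    intro hn
    rw [hτ, timeWeight, Real.smoothTransition.zero_of_nonpos (by linarith), mul_zero]
  have k1 : τ * φ * (2 * (1 + c p.1) * (w p * fderiv ℝ w p (0, 1))) ≤ τ * φ * (C * engOf w p) := by
    by_cases hT : p.2 ≤ T
    · refine mul_le_mul_of_nonneg_left ?_ (by positivity)
      have hC' := hC hT
      have hC0 : 0 ≤ C := by linarith [abs_nonneg (c p.1)]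
      calc 2 * (1 + c p.1) * (w p * fderiv ℝ w p (0, 1))
          ≤ |2 * (1 + c p.1) * (w p * fderiv ℝ w p (0, 1))| := le_abs_self _
        _ = |1 + c p.1| * (|w p * fderiv ℝ w p (0, 1)| * 2) := by
            rw [abs_mul, abs_mul, abs_two]; ring
        _ ≤ C * engOf w p := by
            refine mul_le_mul ?_ hww (by positivity) hC0
            refine (abs_add_le _ _).trans ?_
            rwa [abs_one]
    · rw [hτ0 hT]; simp
  have k2 : τ' * φ * engOf w p ≤ -((C + 1) * τ) * φ * engOf w p := by gcongr
  have k3 : -(η * (τ' * φ)) ≤ η * M := by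
    have : -(τ' * φ) ≤ M := by
      refine (neg_le_abs _).trans ?_
      rw [abs_mul, abs_of_nonneg hφ0]
      calc |τ'| * φ ≤ M * 1 := mul_le_mul hM hφ1 hφ0 hM0
        _ = M := mul_one M
    nlinarith
  have k4 : 2 / ε * τ * φ' * (F - η * p.2) ≤ 0 := by
    by_cases hT : p.2 ≤ T
    · by_cases hn : coneFun p ≤ 2 * ε
      · refine mul_nonpos_of_nonneg_of_nonpos (by positivity) ?_
        linarith [hfl hT hn]
      · have : φ' = 0 := hdz hn
        rw [this]; simp
    · rw [hτ0 hT]; simp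
  have e4 : 2 / ε * τ * φ' * (F - η * p.2) =
      2 / ε * τ * φ' * F - η * (τ * (φ' * ((2 * p.2 * 1 - 2 * 0) / ε))) := by ring
  linarith

/-- Uniqueness for the characteristic initial value problem. -/
theorem wave_unique {c : E3 → ℝ} (hc : Continuous c) (hw : ContDiffOn ℝ 2 w cone)
    (h0 : ∀ x : E3, w (x, ‖x‖) = 0)
    (heq : ∀ p ∈ openCone, hess w p (0, 1) (0, 1) -
      ∑ i, hess w p (basis3 i, 0) (basis3 i, 0) = c p.1 * w p) :
    ∀ p ∈ cone, w p = 0 := by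
  have hw2 : ∀ p ∈ openCone, ContDiffAt ℝ 2 w p := fun p hp => contDiffAt_of_cone hw hp
  suffices h : ∀ p ∈ openCone, w p = 0 by
    rintro ⟨x, t⟩ hp
    rcases (show ‖x‖ ≤ t from hp).lt_or_eq with h1 | h1
    · exact h _ h1
    · rw [← h1]; exact h0 x
  intro p₀ hp₀
  set T := p₀.2 + 1
  obtain ⟨B, hB⟩ := (isCompact_closedBall (0 : E3) T).exists_bound_of_continuousOn hc.continuousOn
  set C := 1 + B
  obtain ⟨M, hM0, hM⟩ := timeWeight'_bound (C + 1) T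
  set vol := (volume : Measure (E3 × ℝ)).real (coneUpTo T)
  have hvol : 0 ≤ vol := measureReal_nonneg
  have hvfin : (volume : Measure (E3 × ℝ)) (coneUpTo T) ≠ ⊤ := by
    have : (volume : Measure (E3 × ℝ)).IsAddHaarMeasure := by
      rw [Measure.volume_eq_prod]; infer_instance
    exact (isCompact_coneUpTo T).measure_ne_top
  have hcut : ∀ ε > 0, ContDiff ℝ 1 (fun p => cutoff (C + 1) T ε p * engOf w p) ∧
      HasCompactSupport (fun p => cutoff (C + 1) T ε p * engOf w p) ∧
      ∀ p ∉ openCone, ∀ v, fderiv ℝ (fun p => cutoff (C + 1) T ε p * engOf w p) p v = 0 :=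
    fun ε hε => cutoff_mul_contDiff hε fun p hp => contDiffAt_engOf (hw2 p hp)
  have hint : ∀ ε > 0, Integrable (fun p => cutoff (C + 1) T ε p * engOf w p) := fun ε hε =>
    (hcut ε hε).1.continuous.integrable_of_hasCompactSupport (hcut ε hε).2.1
  have key : ∀ η > 0, ∃ N > 0, ∀ ε > 0, ε < N →
      ∫ p, cutoff (C + 1) T ε p * engOf w p ≤ η * M * vol := by
    intro η hη
    obtain ⟨N, hN, hN'⟩ := exists_flux_le hw h0 T hη
    refine ⟨N / 2, by positivity, fun ε hε hεN => ?_⟩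
    obtain ⟨a1, a2, a3⟩ := hcut ε hε
    have hb : ∀ i, _ := fun i => cutoff_mul_contDiff (lam := C + 1) (T := T) hε
      (g := current w i) fun p hp => contDiffAt_current (hw2 p hp) i
    obtain ⟨d1, d2, d3⟩ := cutoff_mul_contDiff (lam := C + 1) (T := T) hε
      (g := fun _ => 1) fun p _ => contDiffAt_const
    obtain ⟨i1, j1⟩ := integral_fderiv_eq_zero a1 a2 (0, 1)
    have hi := fun i => integral_fderiv_eq_zero (hb i).1 (hb i).2.1 (basis3 i, 0)
    obtain ⟨i3, j3⟩ := integral_fderiv_eq_zero d1 d2 (0, 1)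
    have i2 := integrable_finsetSum Finset.univ fun i _ => (hi i).1
    have i12 := i1.fun_add i2
    have hG : Integrable (fun p => -(fderiv ℝ (fun z => cutoff (C + 1) T ε z * engOf w z) p (0, 1) +
      ∑ i, fderiv ℝ (fun z => cutoff (C + 1) T ε z * current w i z) p (basis3 i, 0) -
      η * fderiv ℝ (fun z => cutoff (C + 1) T ε z * 1) p (0, 1))) :=
      (i12.sub (i3.const_mul η)).neg
    have hind : Integrable ((coneUpTo T).indicator fun _ => η * M) (volume : Measure (E3 × ℝ)) :=
      (integrable_indicator_iff (isCompact_coneUpTo T).measurableSet).2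
        (integrableOn_const hvfin)
    calc ∫ p, cutoff (C + 1) T ε p * engOf w p
        ≤ _ := integral_mono (hint ε hε) (hG.fun_add hind) ?_
      _ = η * M * vol := by
          rw [integral_add hG hind, integral_neg, integral_sub i12 (i3.const_mul η),
            integral_add i1 i2, j1, integral_finsetSum _ fun i _ => (hi i).1, integral_const_mul, j3,
            integral_indicator (isCompact_coneUpTo T).measurableSet, setIntegral_const]
          simp only [(hi _).2, Finset.sum_const_zero, smul_eq_mul]
          ring
    intro p
    dsimp only
    by_cases hp : p ∈ openCone
    · by_cases hpT : p.2 ≤ T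
      · rw [indicator_of_mem (show p ∈ coneUpTo T from ⟨openCone_subset_cone hp, hpT⟩)]
        refine cutoff_energy_le hp (hw2 p hp) (heq p hp) (fun _ => ?_) hε hη
          (hM _ ((norm_nonneg _).trans_lt hp).le) fun _ hle => hN' p hp hpT (by linarith)
        have : ‖c p.1‖ ≤ B := hB _ (by simpa using (le_of_lt hp).trans hpT)
        rw [Real.norm_eq_abs] at this
        linarith
      · rw [indicator_of_notMem (fun h => hpT h.2)]
        have hpT' : T < p.2 := not_le.1 hpT
        have hz : ∀ g : E3 × ℝ → ℝ, ∀ v, fderiv ℝ (fun z => cutoff (C + 1) T ε z * g z) p v = 0 := by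
          intro g v
          have hev : (fun z => cutoff (C + 1) T ε z * g z) =ᶠ[nhds p] fun _ => 0 := by
            have : ∀ᶠ z : E3 × ℝ in nhds p, T < z.2 :=
              continuous_snd.continuousAt.eventually (lt_mem_nhds hpT')
            filter_upwards [this] with z hz
            rw [cutoff_eq_zero_of_le hz.le, zero_mul]
          rw [hev.fderiv_eq]; simp
        simp only [hz, cutoff_eq_zero_of_le hpT'.le]
        simp
    · have hcp : coneFun p ≤ ε := (not_lt.1 (mt coneFun_pos_iff.1 hp)).trans hε.le
      simp only [a3 p hp, (hb _).2.2 p hp, d3 p hp, cutoff_eq_zero hε hcp]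
      simp only [Finset.sum_const_zero, mul_zero, zero_mul, add_zero, sub_zero, neg_zero, zero_add]
      exact indicator_nonneg (fun _ _ => by positivity) _
  set ε₁ := coneFun p₀ / 2
  have hcp := coneFun_pos_iff.2 hp₀
  have hε₁ : 0 < ε₁ := half_pos hcp
  have hnn : ∀ ε p, 0 ≤ cutoff (C + 1) T ε p * engOf w p := fun ε p =>
    mul_nonneg (cutoff_nonneg _ _ _ _) (engOf_nonneg _)
  have hle : ∫ p, cutoff (C + 1) T ε₁ p * engOf w p ≤ 0 := by
    have : ∀ η > 0, ∫ p, cutoff (C + 1) T ε₁ p * engOf w p ≤ η * (M * vol) := by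
      intro η hη
      obtain ⟨N, hN, hN'⟩ := key η hη
      set ε := min ε₁ (N / 2)
      have hε : 0 < ε := lt_min hε₁ (by positivity)
      rw [← mul_assoc]
      refine le_trans ?_ (hN' ε hε ((min_le_right _ _).trans_lt (by linarith)))
      exact integral_mono (hint _ hε₁) (hint _ hε) fun p =>
        mul_le_mul_of_nonneg_right (cutoff_mono hε (min_le_left _ _) p) (engOf_nonneg _)
    by_contra! hpos
    have h1 := this ((∫ p, cutoff (C + 1) T ε₁ p * engOf w p) / (2 * (M * vol + 1))) (by positivity)
    have h2 : 0 ≤ M * vol := by positivity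
    rw [div_mul_eq_mul_div, le_div_iff₀ (by positivity)] at h1
    nlinarith
  have hz := (Continuous.integral_pos_of_hasCompactSupport_nonneg_nonzero (μ := (volume : Measure (E3 × ℝ)))
    (hcut ε₁ hε₁).1.continuous (hcut ε₁ hε₁).2.1 (hnn ε₁) (x := p₀))
  have hzero : cutoff (C + 1) T ε₁ p₀ * engOf w p₀ = 0 := by
    by_contra hne
    exact (hz hne).not_ge hle
  have hcpos : 0 < cutoff (C + 1) T ε₁ p₀ := by
    refine mul_pos (mul_pos (exp_pos _) (Real.smoothTransition.pos_of_pos ?_))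
      (Real.smoothTransition.pos_of_pos ?_)
    · simp [T]
    · have : coneFun p₀ / ε₁ = 2 := by simp only [ε₁]; field_simp
      rw [this]; norm_num
  have he : engOf w p₀ = 0 := (mul_eq_zero.1 hzero).resolve_left hcpos.ne'
  have hs : 0 ≤ ∑ i, fderiv ℝ w p₀ (basis3 i, 0) ^ 2 := Finset.sum_nonneg fun _ _ => sq_nonneg _
  unfold engOf eng at he
  have : w p₀ ^ 2 = 0 := by nlinarith [sq_nonneg (w p₀), sq_nonneg (fderiv ℝ w p₀ (0, 1))]
  exact pow_eq_zero_iff (by norm_num) |>.1 this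

end energy

lemma basisFun_eq_basis3 (i : Fin 3) : EuclideanSpace.basisFun (Fin 3) ℝ i = basis3 i := by
  simp [basis3]

/-- The trace of a bilinear form is invariant under linear isometries. -/
lemma sum_bilin_isometry (ρ : E3 ≃ₗᵢ[ℝ] E3) (B : E3 →ₗ[ℝ] E3 →ₗ[ℝ] ℝ) :
    ∑ i, B (ρ (basis3 i)) (ρ (basis3 i)) = ∑ i, B (basis3 i) (basis3 i) := by
  have h1 := InnerProductSpace.canonicalCovariantTensor_eq_sum E3 (EuclideanSpace.basisFun (Fin 3) ℝ)
  have h2 := InnerProductSpace.canonicalCovariantTensor_eq_sum E3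
    ((EuclideanSpace.basisFun (Fin 3) ℝ).map ρ)
  have h := congrArg (TensorProduct.lift B) (h2.symm.trans h1)
  simpa only [map_sum, TensorProduct.lift.tmul, OrthonormalBasis.map_apply,
    basisFun_eq_basis3] using h

/-- A linear isometry of space, acting on space-time. -/
def spaceMap (ρ : E3 ≃ₗᵢ[ℝ] E3) : E3 × ℝ →L[ℝ] E3 × ℝ :=
  (ρ.toContinuousLinearEquiv : E3 →L[ℝ] E3).prodMap (ContinuousLinearMap.id ℝ ℝ)

@[simp] lemma spaceMap_apply (ρ : E3 ≃ₗᵢ[ℝ] E3) (x : E3) (t : ℝ) :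
    spaceMap ρ (x, t) = (ρ x, t) := rfl

lemma spaceMap_mem_openCone (ρ : E3 ≃ₗᵢ[ℝ] E3) {p : E3 × ℝ} (hp : p ∈ openCone) :
    spaceMap ρ p ∈ openCone := by
  change ‖ρ p.1‖ < p.2
  rw [ρ.norm_map]; exact hp

lemma hess_eq_fderiv {u : E3 × ℝ → ℝ} {p : E3 × ℝ} (h : ContDiffAt ℝ 2 u p) (v w : E3 × ℝ) :
    hess u p v w = fderiv ℝ (fun z => fderiv ℝ u z w) p v := by
  rw [(hasFDerivAt_fderiv_apply h w).fderiv]; rfl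

lemma hess_comp_spaceMap {u : E3 × ℝ → ℝ} (ρ : E3 ≃ₗᵢ[ℝ] E3) {p : E3 × ℝ}
    (h : ContDiffAt ℝ 2 u (spaceMap ρ p)) (v w : E3 × ℝ) :
    hess (u ∘ spaceMap ρ) p v w = hess u (spaceMap ρ p) (spaceMap ρ v) (spaceMap ρ w) := by
  have hc : ContDiffAt ℝ 2 (u ∘ spaceMap ρ) p := h.comp p (spaceMap ρ).contDiff.contDiffAt
  rw [hess_eq_fderiv hc, hess_eq_fderiv h]
  have hev : (fun z => fderiv ℝ (u ∘ spaceMap ρ) z w) =ᶠ[nhds p]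
      (fun z => fderiv ℝ u z (spaceMap ρ w)) ∘ spaceMap ρ := by
    have h2 : ∀ᶠ z in nhds p, ContDiffAt ℝ 2 u (spaceMap ρ z) :=
      (spaceMap ρ).continuous.continuousAt.eventually (h.eventually (by simp))
    filter_upwards [h2] with z hz
    rw [fderiv_comp z (hz.differentiableAt (by norm_num)) (spaceMap ρ).differentiableAt]
    simp
  rw [hev.fderiv_eq, fderiv_comp p (hasFDerivAt_fderiv_apply h _).differentiableAt
    (spaceMap ρ).differentiableAt]
  simp

lemma hess_sub {u v : E3 × ℝ → ℝ} {p : E3 × ℝ} (hu : ContDiffAt ℝ 2 u p) (hv : ContDiffAt ℝ 2 v p)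
    (a b : E3 × ℝ) : hess (fun z => u z - v z) p a b = hess u p a b - hess v p a b := by
  rw [hess_eq_fderiv hu, hess_eq_fderiv hv, hess_eq_fderiv (hu.sub hv)]
  have hev : (fun z => fderiv ℝ (fun z => u z - v z) z b) =ᶠ[nhds p]
      fun z => fderiv ℝ u z b - fderiv ℝ v z b := by
    filter_upwards [hu.eventually (by simp), hv.eventually (by simp)] with z h1 h2
    rw [fderiv_fun_sub (h1.differentiableAt (by norm_num)) (h2.differentiableAt (by norm_num))]
    simp
  rw [hev.fderiv_eq, fderiv_fun_sub (hasFDerivAt_fderiv_apply hu _).differentiableAt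
    (hasFDerivAt_fderiv_apply hv _).differentiableAt]
  simp

lemma wave_hess {u : E3 × ℝ → ℝ} {p : E3 × ℝ} (h : ContDiffAt ℝ 2 u p) :
    pdt (pdt u) p - lapX u p =
      hess u p (0, 1) (0, 1) - ∑ i, hess u p (basis3 i, 0) (basis3 i, 0) := by
  rw [pdt_pdt_eq h, lapX_eq h]

/-- The wave operator commutes with linear isometries. -/
lemma wave_comp_spaceMap {u : E3 × ℝ → ℝ} (ρ : E3 ≃ₗᵢ[ℝ] E3) {p : E3 × ℝ}
    (h : ContDiffAt ℝ 2 u (spaceMap ρ p)) :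
    hess (u ∘ spaceMap ρ) p (0, 1) (0, 1) -
      ∑ i, hess (u ∘ spaceMap ρ) p (basis3 i, 0) (basis3 i, 0) =
    hess u (spaceMap ρ p) (0, 1) (0, 1) -
      ∑ i, hess u (spaceMap ρ p) (basis3 i, 0) (basis3 i, 0) := by
  simp only [hess_comp_spaceMap ρ h, spaceMap_apply, map_zero]
  congr 1
  exact sum_bilin_isometry ρ ((((fderiv ℝ (fderiv ℝ u) (spaceMap ρ p)).bilinearComp
    (ContinuousLinearMap.inl ℝ E3 ℝ) (ContinuousLinearMap.inl ℝ E3 ℝ))).toLinearMap₁₂)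

lemma exists_isometry_of_norm_eq {x y : E3} (h : ‖x‖ = ‖y‖) : ∃ ρ : E3 ≃ₗᵢ[ℝ] E3, ρ x = y :=
  ⟨_, Submodule.reflection_sub h⟩

/-- The solution of the Goursat problem with radial coefficient is radial in space. -/
theorem goursat_radial {qb : E3 → ℝ} (hqb : Continuous qb)
    (hrad : ∀ x y : E3, ‖x‖ = ‖y‖ → qb x = qb y) {ub : E3 × ℝ → ℝ} (hub : GoursatSol qb ub)
    {x y : E3} {t : ℝ} (hxy : ‖x‖ = ‖y‖) (ht : ‖x‖ ≤ t) : ub (x, t) = ub (y, t) := by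
  obtain ⟨hC, heq, hic⟩ := hub
  obtain ⟨ρ, rfl⟩ := exists_isometry_of_norm_eq hxy
  have hmaps : MapsTo (spaceMap ρ) cone cone := fun p hp => by
    change ‖ρ p.1‖ ≤ p.2
    rw [ρ.norm_map]; exact hp
  have hC' : ContDiffOn ℝ 2 (ub ∘ spaceMap ρ) cone := hC.comp (spaceMap ρ).contDiff.contDiffOn hmaps
  have hq : ∀ z : E3, qb (ρ z) = qb z := fun z => hrad _ _ (ρ.norm_map z)
  have := wave_unique (w := fun p => ub p - (ub ∘ spaceMap ρ) p) hqb (hC.sub hC') (fun z => ?_)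
    (fun p hp => ?_) (x, t) ht
  · simpa [sub_eq_zero] using this
  · have h1 : ‖z‖ = ‖ρ z‖ := (ρ.norm_map z).symm
    simp only [Function.comp, spaceMap_apply]
    nth_rewrite 2 [h1]
    simp only [hic, ← map_smul, hq, sub_self]
  · have hp' := spaceMap_mem_openCone ρ hp
    have d1 := contDiffAt_of_cone hC hp
    have d2 := contDiffAt_of_cone hC' hp
    have d3 := contDiffAt_of_cone hC hp'
    have e1 := heq p hp
    have e2 := heq _ hp'
    have e3 : qb (spaceMap ρ p).1 = qb p.1 := hq p.1
    rw [wave_hess d1] at e1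
    rw [wave_hess d3, ← wave_comp_spaceMap ρ d3, e3] at e2
    simp only [hess_sub d1 d2, Finset.sum_sub_distrib]
    simp only [Function.comp] at e2 ⊢
    linarith

/-- The unit sphere of `ℝ³`. -/
abbrev S2 : Type := sphere (0 : E3) 1

/-- The surface measure on the unit sphere. -/
def sphMeas : Measure S2 := (volume : Measure E3).toSphere

instance : IsFiniteMeasure sphMeas := inferInstanceAs (IsFiniteMeasure (volume : Measure E3).toSphere)

instance : sphMeas.IsOpenPosMeasure :=
  inferInstanceAs (Measure.IsOpenPosMeasure (volume : Measure E3).toSphere)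

lemma norm_coe_sphere (ω : S2) : ‖(ω : E3)‖ = 1 := by simp

/-- A linear isometry acting on the unit sphere. -/
def sphereMap (ρ : E3 ≃ₗᵢ[ℝ] E3) (ω : S2) : S2 :=
  ⟨ρ ω, by simp⟩

lemma continuous_sphereMap (ρ : E3 ≃ₗᵢ[ℝ] E3) : Continuous (sphereMap ρ) :=
  Continuous.subtype_mk (ρ.continuous.comp continuous_subtype_val) _

open scoped Pointwise in
lemma map_sphereMap (ρ : E3 ≃ₗᵢ[ℝ] E3) : sphMeas.map (sphereMap ρ) = sphMeas := by
  ext s hs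
  have hm := (continuous_sphereMap ρ).measurable
  rw [Measure.map_apply hm hs, sphMeas, Measure.toSphere_apply' _ (hm hs), Measure.toSphere_apply' _ hs]
  congr 1
  rw [← ρ.measurePreserving.measure_preimage_equiv (f := ρ.toMeasurableEquiv) (Ioo (0 : ℝ) 1 • (Subtype.val '' s))]
  congr 1
  ext x
  simp only [mem_smul, mem_image, mem_preimage]
  constructor
  · rintro ⟨c, hc, y, ⟨ω, hω, rfl⟩, rfl⟩
    exact ⟨c, hc, _, ⟨_, hω, rfl⟩, by simp [sphereMap]⟩
  · rintro ⟨c, hc, y, ⟨ω, hω, rfl⟩, h⟩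
    refine ⟨c, hc, _, ⟨sphereMap ρ.symm ω, ?_, rfl⟩, ?_⟩
    · convert hω
      ext1
      simp [sphereMap]
    · apply ρ.injective
      simpa [sphereMap] using h

lemma integral_sphereMap (ρ : E3 ≃ₗᵢ[ℝ] E3) {f : S2 → ℝ} (hf : Continuous f) :
    ∫ ω, f (sphereMap ρ ω) ∂sphMeas = ∫ ω, f ω ∂sphMeas := by
  conv_rhs => rw [← map_sphereMap ρ]
  exact (integral_map (continuous_sphereMap ρ).aemeasurable hf.aestronglyMeasurable).symm

lemma integrable_sphere {f : S2 → ℝ} (hf : Continuous f) : Integrable f sphMeas :=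
  hf.integrable_of_hasCompactSupport (HasCompactSupport.of_compactSpace f)

/-- Differentiation under the integral over the sphere. -/
lemma hasDerivAt_integral_sphere {F F' : ℝ → S2 → ℝ} {s₀ : ℝ} {U : Set ℝ} (hU : U ∈ nhds s₀)
    (hF : ∀ s ∈ U, Continuous (F s))
    (hF' : ContinuousOn (fun z : ℝ × S2 => F' z.1 z.2) (U ×ˢ univ))
    (hd : ∀ s ∈ U, ∀ ω, HasDerivAt (fun s => F s ω) (F' s ω) s) :
    HasDerivAt (fun s => ∫ ω, F s ω ∂sphMeas) (∫ ω, F' s₀ ω ∂sphMeas) s₀ := by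
  obtain ⟨ε, hε, hεU⟩ := Metric.nhds_basis_closedBall.mem_iff.1 hU
  obtain ⟨B, hB⟩ := ((isCompact_closedBall s₀ ε).prod (isCompact_univ (X := S2))).exists_bound_of_continuousOn
    (hF'.mono (prod_mono hεU subset_rfl))
  have hs₀ : s₀ ∈ U := mem_of_mem_nhds hU
  have hF's : Continuous (F' s₀) := by
    have : ContinuousOn (fun ω : S2 => F' s₀ ω) univ :=
      hF'.comp (f := fun ω : S2 => (s₀, ω)) (Continuous.continuousOn (by fun_prop))
        fun ω _ => ⟨hs₀, mem_univ _⟩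
    exact continuousOn_univ.1 this
  refine (hasDerivAt_integral_of_dominated_loc_of_deriv_le (bound := fun _ => B)
    (Metric.closedBall_mem_nhds s₀ hε) ?_ (integrable_sphere (hF _ hs₀))
    hF's.aestronglyMeasurable ?_ (integrable_const B) ?_).2
  · filter_upwards [hU] with s hs
    exact (hF s hs).aestronglyMeasurable
  · exact Filter.Eventually.of_forall fun ω s hs => hB (s, ω) ⟨hs, mem_univ _⟩
  · exact Filter.Eventually.of_forall fun ω s hs => hd s (hεU hs) ω

/-- The infinitesimal rotation `x ↦ xᵢ eⱼ - xⱼ eᵢ`. -/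
def rotGen (i j : Fin 3) : E3 →L[ℝ] E3 :=
  (EuclideanSpace.proj i : E3 →L[ℝ] ℝ).smulRight (basis3 j) -
    (EuclideanSpace.proj j : E3 →L[ℝ] ℝ).smulRight (basis3 i)

lemma rotGen_apply (i j : Fin 3) (x : E3) : rotGen i j x = x i • basis3 j - x j • basis3 i := by
  simp [rotGen]

lemma rotGen_sq {i j : Fin 3} (hij : i ≠ j) (x : E3) :
    rotGen i j (rotGen i j x) = -(x i • basis3 i + x j • basis3 j) := by
  simp [rotGen_apply, basis3, hij, hij.symm]
  abel

/-- The rotation by the angle `θ` in the plane of `eᵢ` and `eⱼ`, as a linear map. -/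
def rotLin (i j : Fin 3) (θ : ℝ) (x : E3) : E3 :=
  x + (sin θ • rotGen i j x + (1 - cos θ) • rotGen i j (rotGen i j x))

lemma norm_rotLin {i j : Fin 3} (hij : i ≠ j) (θ : ℝ) (x : E3) : ‖rotLin i j θ x‖ = ‖x‖ := by
  have h : ‖rotLin i j θ x‖ ^ 2 = ‖x‖ ^ 2 := by
    have hsc := sin_sq_add_cos_sq θ
    rw [rotLin, rotGen_sq hij, rotGen_apply, EuclideanSpace.real_norm_sq_eq,
      EuclideanSpace.real_norm_sq_eq, Fin.sum_univ_three, Fin.sum_univ_three]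
    fin_cases i <;> fin_cases j <;> simp [basis3] at hij ⊢ <;>
      first
      | linear_combination ((x 0) ^ 2 + (x 1) ^ 2) * hsc
      | linear_combination ((x 0) ^ 2 + (x 2) ^ 2) * hsc
      | linear_combination ((x 1) ^ 2 + (x 2) ^ 2) * hsc
  exact (pow_left_inj₀ (norm_nonneg _) (norm_nonneg _) (by norm_num)).1 h

/-- The rotation by the angle `θ` in the plane of `eᵢ` and `eⱼ`. -/
def rotIso {i j : Fin 3} (hij : i ≠ j) (θ : ℝ) : E3 ≃ₗᵢ[ℝ] E3 :=
  LinearIsometry.toLinearIsometryEquiv (F := E3)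
    { toFun := rotLin i j θ
      map_add' := fun x y => by simp only [rotLin, map_add, smul_add]; abel
      map_smul' := fun c x => by
        simp only [rotLin, map_smul, smul_add, RingHom.id_apply, smul_comm c]
      norm_map' := norm_rotLin hij θ } rfl

lemma rotIso_apply {i j : Fin 3} (hij : i ≠ j) (θ : ℝ) (x : E3) :
    rotIso hij θ x = x + (sin θ • rotGen i j x + (1 - cos θ) • rotGen i j (rotGen i j x)) := rfl

/-- The integral over the sphere of an angular derivative vanishes. -/
lemma integral_rotGen_eq_zero {i j : Fin 3} (hij : i ≠ j) {g : E3 → ℝ}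
    (hg : ∀ ω : S2, ContDiffAt ℝ 1 g ω) :
    ∫ ω : S2, fderiv ℝ g ω (rotGen i j ω) ∂sphMeas = 0 := by
  have hgc : Continuous fun ω : S2 => g ω :=
    continuous_iff_continuousAt.2 fun ω =>
      (hg ω).continuousAt.comp (f := fun ω : S2 => (ω : E3)) continuous_subtype_val.continuousAt
  have hdc : Continuous fun ω : S2 => fderiv ℝ g ω :=
    continuous_iff_continuousAt.2 fun ω =>
      ((hg ω).fderiv_right (m := 0) (by norm_num)).continuousAt.comp (f := fun ω : S2 => (ω : E3))
        continuous_subtype_val.continuousAt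
  have hmap : Continuous fun z : ℝ × S2 => sphereMap (rotIso hij z.1) z.2 := by
    refine Continuous.subtype_mk ?_ _
    simp only [rotIso_apply]
    fun_prop
  have hcurve : ∀ (ω : S2) (s : ℝ), HasDerivAt (fun s => rotIso hij s (ω : E3))
      (cos s • rotGen i j ω + sin s • rotGen i j (rotGen i j ω)) s := by
    intro ω s
    simp only [rotIso_apply]
    have h1 := (hasDerivAt_sin s).smul_const (rotGen i j (ω : E3))
    have h2 := ((hasDerivAt_cos s).const_sub 1).smul_const (rotGen i j (rotGen i j (ω : E3)))
    rw [neg_neg] at h2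
    exact (h1.add h2).const_add (ω : E3)
  have h := hasDerivAt_integral_sphere (s₀ := 0) (U := univ)
    (F := fun s ω => g (sphereMap (rotIso hij s) ω))
    (F' := fun s ω => fderiv ℝ g (sphereMap (rotIso hij s) ω)
      (cos s • rotGen i j ω + sin s • rotGen i j (rotGen i j ω))) Filter.univ_mem
    (fun s _ => hgc.comp (continuous_sphereMap _))
    (Continuous.continuousOn ((hdc.comp hmap).clm_apply (by fun_prop)))
    (fun s _ ω => ((hg _).differentiableAt (by norm_num)).hasFDerivAt.comp_hasDerivAt s (hcurve ω s))
  have hconst : (fun s : ℝ => ∫ ω, g (sphereMap (rotIso hij s) ω) ∂sphMeas) =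
      fun _ => ∫ ω : S2, g ω ∂sphMeas :=
    funext fun s => integral_sphereMap (rotIso hij s) hgc
  rw [hconst] at h
  have h0 := h.unique (hasDerivAt_const _ _)
  have hid : ∀ ω : S2, (sphereMap (rotIso hij 0) ω : E3) = ω := fun ω => by
    simp [sphereMap, rotIso_apply]
  simpa [hid] using h0

lemma eq_sum_basis3 (x : E3) : x = x 0 • basis3 0 + x 1 • basis3 1 + x 2 • basis3 2 := by
  ext j
  fin_cases j <;> simp [basis3]

/-- The sum of a quadratic form over the three infinitesimal rotations. -/
lemma sum_rotGen_bilin (B : E3 →L[ℝ] E3 →L[ℝ] ℝ) (hB : ∀ v w, B v w = B w v) (x : E3) :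
    B (rotGen 0 1 x) (rotGen 0 1 x) + B (rotGen 0 2 x) (rotGen 0 2 x) +
      B (rotGen 1 2 x) (rotGen 1 2 x) = ‖x‖ ^ 2 * ∑ i, B (basis3 i) (basis3 i) - B x x := by
  have hx : B x x = B (x 0 • basis3 0 + x 1 • basis3 1 + x 2 • basis3 2)
      (x 0 • basis3 0 + x 1 • basis3 1 + x 2 • basis3 2) := by rw [← eq_sum_basis3]
  rw [hx, EuclideanSpace.real_norm_sq_eq]
  simp only [Fin.sum_univ_three, rotGen_apply, map_sub, map_add, map_smul, _root_.add_apply,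
    _root_.sub_apply, _root_.smul_apply, smul_eq_mul, hB (basis3 1) (basis3 0),
    hB (basis3 2) (basis3 0), hB (basis3 2) (basis3 1)]
  ring

lemma sum_rotGen_sq (L : E3 →L[ℝ] ℝ) (x : E3) :
    L (rotGen 0 1 (rotGen 0 1 x)) + L (rotGen 0 2 (rotGen 0 2 x)) +
      L (rotGen 1 2 (rotGen 1 2 x)) = -(2 * L x) := by
  have hx : L x = L (x 0 • basis3 0 + x 1 • basis3 1 + x 2 • basis3 2) := by rw [← eq_sum_basis3]
  rw [hx, rotGen_sq (by decide), rotGen_sq (by decide), rotGen_sq (by decide)]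
  simp only [map_neg, map_add, map_smul, smul_eq_mul]
  ring

/-- Powers of linear forms. -/
def linPow (a : E3) (l : ℕ) (x : E3) : ℝ := inner ℝ a x ^ l

@[fun_prop]
lemma contDiff_linPow (a : E3) (l : ℕ) : ContDiff ℝ 2 (linPow a l) :=
  (innerSL ℝ a).contDiff.pow l

@[fun_prop]
lemma continuous_linPow (a : E3) (l : ℕ) : Continuous (linPow a l) :=
  (contDiff_linPow a l).continuous

lemma hasFDerivAt_linPow (a : E3) (l : ℕ) (x : E3) :
    HasFDerivAt (linPow a l) ((l * linPow a (l - 1) x) • innerSL ℝ a) x := by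
  have h : HasFDerivAt (fun y => innerSL ℝ a y) (innerSL ℝ a) x := (innerSL ℝ a).hasFDerivAt
  refine (h.pow l).congr_fderiv ?_
  ext v
  simp [linPow]

section

variable {u : E3 × ℝ → ℝ} {r t : ℝ}

lemma hasFDerivAt_scale (x : E3) : HasFDerivAt (fun y : E3 => ((r • y, t) : E3 × ℝ))
    (r • ContinuousLinearMap.inl ℝ E3 ℝ) x := by
  have h : HasFDerivAt (fun y : E3 => ((r • y, t) : E3 × ℝ))
    ((r • ContinuousLinearMap.id ℝ E3).prod 0) x :=
    ((hasFDerivAt_id x).const_smul r).prodMk (hasFDerivAt_const t x)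
  refine h.congr_fderiv ?_
  ext v <;> simp

lemma hasFDerivAt_fderiv_scale {x : E3} (h : ContDiffAt ℝ 2 u (r • x, t)) (A : E3 →L[ℝ] E3) :
    ∃ M : E3 →L[ℝ] ℝ, HasFDerivAt (fun y => fderiv ℝ u (r • y, t) (A y, 0)) M x ∧
      ∀ v, M v = r * hess u (r • x, t) (v, 0) (A x, 0) + fderiv ℝ u (r • x, t) (A v, 0) := by
  have h1 : HasFDerivAt (fun y => fderiv ℝ u (r • y, t)) _ x :=
    h.differentiableAt_fderiv_two.hasFDerivAt.comp x (hasFDerivAt_scale x)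
  have h2 : HasFDerivAt (fun y => ((A y, 0) : E3 × ℝ)) ((ContinuousLinearMap.inl ℝ E3 ℝ).comp A) x :=
    ((ContinuousLinearMap.inl ℝ E3 ℝ).comp A).hasFDerivAt
  refine ⟨_, h1.clm_apply h2, fun v => ?_⟩
  simp [hess]
  ring

lemma contDiffAt_fderiv_scale {x : E3} (h : ContDiffAt ℝ 2 u (r • x, t)) (A : E3 →L[ℝ] E3) :
    ContDiffAt ℝ 1 (fun y => fderiv ℝ u (r • y, t) (A y, 0)) x := by
  have h1 : ContDiffAt ℝ 1 (fun y => fderiv ℝ u (r • y, t)) x :=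
    (h.fderiv_right (m := 1) (by norm_num)).comp x (by fun_prop)
  exact h1.clm_apply (by fun_prop)

lemma contDiffAt_scale {x : E3} (h : ContDiffAt ℝ 2 u (r • x, t)) :
    ContDiffAt ℝ 2 (fun y => u (r • y, t)) x := h.comp x (by fun_prop)

/-- The angular derivative of a power of a linear form. -/
def linPowRot (a : E3) (l : ℕ) (i j : Fin 3) (x : E3) : ℝ :=
  l * linPow a (l - 1) x * inner ℝ a (rotGen i j x)

lemma hasFDerivAt_linPowRot (a : E3) (l : ℕ) (i j : Fin 3) (x : E3) :
    ∃ M : E3 →L[ℝ] ℝ, HasFDerivAt (linPowRot a l i j) M x ∧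
      ∀ v, M v = l * ((l - 1 : ℕ) * linPow a (l - 1 - 1) x * inner ℝ a v) * inner ℝ a (rotGen i j x) +
        l * linPow a (l - 1) x * inner ℝ a (rotGen i j v) := by
  have h1 := (hasFDerivAt_linPow a (l - 1) x).const_mul (l : ℝ)
  have h2 : HasFDerivAt (fun y => inner ℝ a (rotGen i j y)) ((innerSL ℝ a).comp (rotGen i j)) x :=
    ((innerSL ℝ a).comp (rotGen i j)).hasFDerivAt
  refine ⟨_, h1.mul h2, fun v => ?_⟩
  simp
  ring

lemma contDiff_linPowRot (a : E3) (l : ℕ) (i j : Fin 3) : ContDiff ℝ 1 (linPowRot a l i j) :=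
  (contDiff_const.mul ((contDiff_linPow a (l - 1)).of_le (by norm_num))).mul
    ((innerSL ℝ a).comp (rotGen i j)).contDiff

/-- Twofold integration by parts on the sphere, for a single infinitesimal rotation. -/
lemma integral_rotGen_parts {i j : Fin 3} (hij : i ≠ j) (hu : ∀ ω : S2, ContDiffAt ℝ 2 u (r • (ω : E3), t))
    (a : E3) (l : ℕ) :
    ∃ f₁ f₂ : S2 → ℝ, Integrable f₁ sphMeas ∧ Integrable f₂ sphMeas ∧ ∫ ω, f₁ ω ∂sphMeas = 0 ∧
      ∫ ω, f₂ ω ∂sphMeas = 0 ∧ ∀ ω : S2, r * f₁ ω - f₂ ω =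
        (r ^ 2 * hess u (r • (ω : E3), t) (rotGen i j ω, 0) (rotGen i j ω, 0) +
          r * fderiv ℝ u (r • (ω : E3), t) (rotGen i j (rotGen i j ω), 0)) * linPow a l ω -
        u (r • (ω : E3), t) * (l * (l - 1 : ℕ) * linPow a (l - 1 - 1) ω * inner ℝ a (rotGen i j ω) ^ 2 +
          l * linPow a (l - 1) ω * inner ℝ a (rotGen i j (rotGen i j ω))) := by
  have hg₁ : ∀ ω : S2, ContDiffAt ℝ 1
      (fun x => fderiv ℝ u (r • x, t) (rotGen i j x, 0) * linPow a l x) ω := fun ω =>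
    (contDiffAt_fderiv_scale (hu ω) _).mul ((contDiff_linPow a l).of_le (by norm_num)).contDiffAt
  have hg₂ : ∀ ω : S2, ContDiffAt ℝ 1 (fun x => u (r • x, t) * linPowRot a l i j x) ω := fun ω =>
    ((contDiffAt_scale (hu ω)).of_le (by norm_num)).mul (contDiff_linPowRot a l i j).contDiffAt
  have hc : ∀ {g : E3 → ℝ}, (∀ ω : S2, ContDiffAt ℝ 1 g ω) →
      Integrable (fun ω : S2 => fderiv ℝ g ω (rotGen i j ω)) sphMeas := fun hg =>
    integrable_sphere ((continuous_iff_continuousAt.2 fun ω =>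
      ((hg ω).fderiv_right (m := 0) (by norm_num)).continuousAt.comp (f := fun ω : S2 => (ω : E3))
        continuous_subtype_val.continuousAt).clm_apply (by fun_prop))
  refine ⟨_, _, hc hg₁, hc hg₂, integral_rotGen_eq_zero hij hg₁, integral_rotGen_eq_zero hij hg₂,
    fun ω => ?_⟩
  obtain ⟨M₁, h₁, e₁⟩ := hasFDerivAt_fderiv_scale (hu ω) (rotGen i j)
  obtain ⟨M₂, h₂, e₂⟩ := hasFDerivAt_linPowRot a l i j ω
  have h₃ := ((hu ω).differentiableAt (by norm_num)).hasFDerivAt.comp (ω : E3) (hasFDerivAt_scale (ω : E3))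
  have k₁ := (h₁.mul (hasFDerivAt_linPow a l ω)).fderiv
  have k₂ := (h₃.mul h₂).fderiv
  have k₁' : fderiv ℝ (fun x => fderiv ℝ u (r • x, t) (rotGen i j x, 0) * linPow a l x) ω = _ := k₁
  have k₂' : fderiv ℝ (fun x => u (r • x, t) * linPowRot a l i j x) ω = _ := k₂
  rw [k₁', k₂']
  simp [e₁, e₂, linPowRot]
  ring

/-- Integration by parts for the Laplacian on the sphere against a power of a linear form. -/
lemma integral_sphere_laplacian (hu : ∀ ω : S2, ContDiffAt ℝ 2 u (r • (ω : E3), t)) (a : E3) (l : ℕ) :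
    ∫ ω : S2, (r ^ 2 * (∑ i, hess u (r • (ω : E3), t) (basis3 i, 0) (basis3 i, 0) -
        hess u (r • (ω : E3), t) ((ω : E3), 0) ((ω : E3), 0)) -
        2 * r * fderiv ℝ u (r • (ω : E3), t) ((ω : E3), 0)) * linPow a l ω -
      u (r • (ω : E3), t) * (l * (l - 1 : ℕ) * ‖a‖ ^ 2 * linPow a (l - 2) ω -
        l * (l + 1) * linPow a l ω) ∂sphMeas = 0 := by
  obtain ⟨f₁, f₂, i₁, i₂, j₁, j₂, e₁⟩ := integral_rotGen_parts (i := 0) (j := 1) (by decide) hu a l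
  obtain ⟨f₃, f₄, i₃, i₄, j₃, j₄, e₂⟩ := integral_rotGen_parts (i := 0) (j := 2) (by decide) hu a l
  obtain ⟨f₅, f₆, i₅, i₆, j₅, j₆, e₃⟩ := integral_rotGen_parts (i := 1) (j := 2) (by decide) hu a l
  have h : ∫ ω, (r * f₁ ω - f₂ ω) + (r * f₃ ω - f₄ ω) + (r * f₅ ω - f₆ ω) ∂sphMeas = 0 := by
    have k₁ : Integrable (fun ω => r * f₁ ω - f₂ ω) sphMeas := (i₁.const_mul r).sub i₂
    have k₂ : Integrable (fun ω => r * f₃ ω - f₄ ω) sphMeas := (i₃.const_mul r).sub i₄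
    have k₃ : Integrable (fun ω => r * f₅ ω - f₆ ω) sphMeas := (i₅.const_mul r).sub i₆
    rw [integral_add (k₁.fun_add k₂) k₃, integral_add k₁ k₂,
      integral_sub (i₁.const_mul r) i₂, integral_sub (i₃.const_mul r) i₄,
      integral_sub (i₅.const_mul r) i₆]
    simp only [integral_const_mul, j₁, j₂, j₃, j₄, j₅, j₆]
    simp
  refine Eq.trans ?_ h
  refine integral_congr_ae (Filter.Eventually.of_forall fun ω => ?_)
  simp only [e₁, e₂, e₃]
  have b₁ := sum_rotGen_bilin ((fderiv ℝ (fderiv ℝ u) (r • (ω : E3), t)).bilinearComp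
    (ContinuousLinearMap.inl ℝ E3 ℝ) (ContinuousLinearMap.inl ℝ E3 ℝ))
    (fun v w => hess_comm (hu ω) (v, 0) (w, 0)) ω
  have b₂ := sum_rotGen_sq ((fderiv ℝ u (r • (ω : E3), t)).comp (ContinuousLinearMap.inl ℝ E3 ℝ)) ω
  have b₃ := sum_rotGen_bilin ((innerSL ℝ a).smulRight (innerSL ℝ a)) (fun v w => by simp; ring) ω
  have b₄ := sum_rotGen_sq (innerSL ℝ a) ω
  have hnorm : ∑ i, inner ℝ a (basis3 i) * inner ℝ a (basis3 i) = ‖a‖ ^ 2 := by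
    rw [EuclideanSpace.real_norm_sq_eq]
    simp [basis3, EuclideanSpace.inner_single_right, sq]
  simp only [ContinuousLinearMap.bilinearComp_apply, ContinuousLinearMap.inl_apply,
    ContinuousLinearMap.comp_apply, norm_coe_sphere, ContinuousLinearMap.smulRight_apply,
    _root_.smul_apply, innerSL_apply_apply, smul_eq_mul, hnorm] at b₁ b₂ b₃ b₄
  have p₁ : (l : ℝ) * linPow a (l - 1) ω * inner ℝ a (ω : E3) = l * linPow a l ω := by
    rcases l with _ | l
    · simp
    · simp [linPow, pow_succ]; ring
  have p₂ : (l : ℝ) * (l - 1 : ℕ) * linPow a (l - 1 - 1) ω * (inner ℝ a (ω : E3) * inner ℝ a (ω : E3)) =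
      l * (l - 1) * linPow a l ω := by
    rcases l with _ | _ | l
    · simp
    · simp
    · simp [linPow, pow_succ]; ring
  rw [show l - 2 = l - 1 - 1 by omega]
  simp only [hess]
  linear_combination -r ^ 2 * linPow a l ω * b₁ - r * linPow a l ω * b₂ +
    u (r • (ω : E3), t) * (l * (l - 1 : ℕ) * linPow a (l - 1 - 1) ω * b₃ + l * linPow a (l - 1) ω * b₄) -
    u (r • (ω : E3), t) * (p₂ + 2 * p₁)

end

/-- The weighted spherical mean of `u` at radius `r` and time `t`. -/
def modeI (f : E3 → ℝ) (u : E3 × ℝ → ℝ) (r t : ℝ) : ℝ :=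
  ∫ ω : S2, u (r • (ω : E3), t) * f ω ∂sphMeas

/-- The weighted spherical mean of the radial derivative of `u`. -/
def modeR (f : E3 → ℝ) (u : E3 × ℝ → ℝ) (r t : ℝ) : ℝ :=
  ∫ ω : S2, fderiv ℝ u (r • (ω : E3), t) ((ω : E3), 0) * f ω ∂sphMeas

/-- The weighted spherical mean of the time derivative of `u`. -/
def modeT (f : E3 → ℝ) (u : E3 × ℝ → ℝ) (r t : ℝ) : ℝ :=
  ∫ ω : S2, fderiv ℝ u (r • (ω : E3), t) (0, 1) * f ω ∂sphMeas

/-- The weighted spherical mean of the second radial derivative of `u`. -/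
def modeRR (f : E3 → ℝ) (u : E3 × ℝ → ℝ) (r t : ℝ) : ℝ :=
  ∫ ω : S2, hess u (r • (ω : E3), t) ((ω : E3), 0) ((ω : E3), 0) * f ω ∂sphMeas

/-- The weighted spherical mean of the mixed radial and time derivative of `u`. -/
def modeRT (f : E3 → ℝ) (u : E3 × ℝ → ℝ) (r t : ℝ) : ℝ :=
  ∫ ω : S2, hess u (r • (ω : E3), t) ((ω : E3), 0) (0, 1) * f ω ∂sphMeas

/-- The weighted spherical mean of the second time derivative of `u`. -/
def modeTT (f : E3 → ℝ) (u : E3 × ℝ → ℝ) (r t : ℝ) : ℝ :=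
  ∫ ω : S2, hess u (r • (ω : E3), t) (0, 1) (0, 1) * f ω ∂sphMeas

section

variable {u : E3 × ℝ → ℝ} {f : E3 → ℝ} {r t κ : ℝ} {τ : ℝ → ℝ}

lemma smul_mem_openCone {s t : ℝ} (h : |s| < t) (ω : S2) : (s • (ω : E3), t) ∈ openCone := by
  simpa [openCone, norm_smul] using h

lemma continuousOn_fderiv_openCone (hu : ContDiffOn ℝ 2 u cone) :
    ContinuousOn (fderiv ℝ u) openCone := fun _ hp =>
  (contDiffAt_of_cone hu hp).differentiableAt_fderiv_two.continuousAt.continuousWithinAt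

lemma continuousOn_hess_openCone (hu : ContDiffOn ℝ 2 u cone) :
    ContinuousOn (fderiv ℝ (fderiv ℝ u)) openCone := fun _ hp =>
  ((((contDiffAt_of_cone hu hp).fderiv_right (m := 1) (by norm_num)).fderiv_right
    (m := 0) (by norm_num)).continuousAt).continuousWithinAt

/-- A continuous function on the open cone, restricted to a sphere. -/
lemma ContinuousOn.comp_sphere {Z : Type*} [TopologicalSpace Z] {H : E3 × ℝ → Z}
    (hH : ContinuousOn H openCone) (h : |r| < t) : Continuous fun ω : S2 => H (r • (ω : E3), t) :=
  hH.comp_continuous (by fun_prop) (smul_mem_openCone h)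

/-- Differentiation of a weighted spherical mean along a curve in the `(r,t)` half plane. -/
lemma hasDerivAt_sphere_mean {F : E3 × ℝ → S2 → ℝ} {G : E3 × ℝ → S2 → ℝ} (hf : Continuous f)
    (hF : ContinuousOn (fun z : (E3 × ℝ) × S2 => F z.1 z.2) (openCone ×ˢ univ))
    (hG : ContinuousOn (fun z : (E3 × ℝ) × S2 => G z.1 z.2) (openCone ×ˢ univ))
    (hτ : ∀ s, HasDerivAt τ κ s) (hτr : τ r = t) (hr : |r| < t)
    (hd : ∀ s, |s| < τ s → ∀ ω : S2, HasDerivAt (fun s => F (s • (ω : E3), τ s) ω)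
      (G (s • (ω : E3), τ s) ω) s) :
    HasDerivAt (fun s => ∫ ω : S2, F (s • (ω : E3), τ s) ω * f ω ∂sphMeas)
      (∫ ω : S2, G (r • (ω : E3), t) ω * f ω ∂sphMeas) r := by
  have hτc : Continuous τ := continuous_iff_continuousAt.2 fun s => (hτ s).continuousAt
  have hU : {s | |s| < τ s} ∈ nhds r :=
    (isOpen_lt (by fun_prop) hτc).mem_nhds (by simpa [hτr] using hr)
  have key := hasDerivAt_integral_sphere (F := fun s ω => F (s • (ω : E3), τ s) ω * f ω)
    (F' := fun s ω => G (s • (ω : E3), τ s) ω * f ω) hU (fun s hs => ?_) ?_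
    (fun s hs ω => (hd s hs ω).mul_const _)
  · simpa only [hτr] using key
  · exact (hF.comp_continuous (f := fun ω : S2 => ((s • (ω : E3), τ s), ω)) (by fun_prop)
      (fun ω => ⟨smul_mem_openCone hs ω, mem_univ _⟩)).mul (by fun_prop)
  · refine (hG.comp (f := fun z : ℝ × S2 => ((z.1 • (z.2 : E3), τ z.1), z.2))
      (Continuous.continuousOn (by fun_prop))
      (fun z hz => ⟨smul_mem_openCone hz.1 z.2, mem_univ _⟩)).mul (Continuous.continuousOn (by fun_prop))

lemma hasDerivAt_curve (hτ : ∀ s, HasDerivAt τ κ s) (x : E3) (s : ℝ) :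
    HasDerivAt (fun s => ((s • x, τ s) : E3 × ℝ)) (x, κ) s := by
  have := ((hasDerivAt_id s).smul_const x).prodMk (hτ s)
  simpa using this

lemma prod_decomp (x : E3) (κ : ℝ) : ((x, κ) : E3 × ℝ) = (x, 0) + κ • (0, 1) := by simp

lemma hasDerivAt_modeI (hu : ContDiffOn ℝ 2 u cone) (hf : Continuous f)
    (hτ : ∀ s, HasDerivAt τ κ s) (hτr : τ r = t) (hr : |r| < t) :
    HasDerivAt (fun s => modeI f u s (τ s)) (modeR f u r t + κ * modeT f u r t) r := by
  have hD := continuousOn_fderiv_openCone hu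
  have hD' : ContinuousOn (fun z : (E3 × ℝ) × S2 => fderiv ℝ u z.1) (openCone ×ˢ univ) :=
    hD.comp continuousOn_fst fun z hz => hz.1
  have key := hasDerivAt_sphere_mean (F := fun p _ => u p)
    (G := fun p ω => fderiv ℝ u p ((ω : E3), κ)) hf
    ((hu.continuousOn.mono openCone_subset_cone).comp continuousOn_fst fun z hz => hz.1)
    (hD'.clm_apply (Continuous.continuousOn (by fun_prop))) hτ hτr hr
    (fun s hs ω => ((contDiffAt_of_cone hu (smul_mem_openCone hs ω)).differentiableAt
      (by norm_num)).hasFDerivAt.comp_hasDerivAt s (hasDerivAt_curve hτ _ s))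
  refine key.congr_deriv ?_
  have hc := hD.comp_sphere hr
  rw [modeR, modeT, ← integral_const_mul, ← integral_add]
  · refine integral_congr_ae (Filter.Eventually.of_forall fun ω => ?_)
    simp only
    rw [prod_decomp (ω : E3) κ, map_add, map_smul, smul_eq_mul]
    ring
  · exact integrable_sphere ((hc.clm_apply (by fun_prop)).mul (by fun_prop))
  · exact (integrable_sphere ((hc.clm_apply (by fun_prop)).mul (by fun_prop))).const_mul _

/-- The derivative of the mean of a first derivative along a curve. -/
lemma hasDerivAt_mode_fderiv (hu : ContDiffOn ℝ 2 u cone) (hf : Continuous f)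
    (hτ : ∀ s, HasDerivAt τ κ s) (hτr : τ r = t) (hr : |r| < t) {v : S2 → E3 × ℝ}
    (hv : Continuous v) :
    HasDerivAt (fun s => ∫ ω : S2, fderiv ℝ u (s • (ω : E3), τ s) (v ω) * f ω ∂sphMeas)
      ((∫ ω : S2, hess u (r • (ω : E3), t) ((ω : E3), 0) (v ω) * f ω ∂sphMeas) +
        κ * ∫ ω : S2, hess u (r • (ω : E3), t) (0, 1) (v ω) * f ω ∂sphMeas) r := by
  have hD := continuousOn_fderiv_openCone hu
  have hH := continuousOn_hess_openCone hu
  have hD' : ContinuousOn (fun z : (E3 × ℝ) × S2 => fderiv ℝ u z.1) (openCone ×ˢ univ) :=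
    hD.comp continuousOn_fst fun z hz => hz.1
  have hH' : ContinuousOn (fun z : (E3 × ℝ) × S2 => fderiv ℝ (fderiv ℝ u) z.1) (openCone ×ˢ univ) :=
    hH.comp continuousOn_fst fun z hz => hz.1
  have key := hasDerivAt_sphere_mean (F := fun p ω => fderiv ℝ u p (v ω))
    (G := fun p ω => hess u p ((ω : E3), κ) (v ω)) hf
    (hD'.clm_apply (Continuous.continuousOn (by fun_prop)))
    ((hH'.clm_apply (Continuous.continuousOn (by fun_prop))).clm_apply
      (Continuous.continuousOn (by fun_prop))) hτ hτr hr
    (fun s hs ω => (hasFDerivAt_fderiv_apply (contDiffAt_of_cone hu (smul_mem_openCone hs ω))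
      (v ω)).comp_hasDerivAt (f := fun s => ((s • (ω : E3), τ s) : E3 × ℝ)) s (hasDerivAt_curve hτ _ s))
  refine key.congr_deriv ?_
  have hc := hH.comp_sphere hr
  rw [← integral_const_mul, ← integral_add]
  · refine integral_congr_ae (Filter.Eventually.of_forall fun ω => ?_)
    simp only [hess]
    rw [prod_decomp (ω : E3) κ, map_add, map_smul, _root_.add_apply, _root_.smul_apply, smul_eq_mul]
    ring
  · exact integrable_sphere (((hc.clm_apply (by fun_prop)).clm_apply (by fun_prop)).mul (by fun_prop))
  · exact (integrable_sphere
      (((hc.clm_apply (by fun_prop)).clm_apply (by fun_prop)).mul (by fun_prop))).const_mul _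

lemma hasDerivAt_modeR (hu : ContDiffOn ℝ 2 u cone) (hf : Continuous f)
    (hτ : ∀ s, HasDerivAt τ κ s) (hτr : τ r = t) (hr : |r| < t) :
    HasDerivAt (fun s => modeR f u s (τ s)) (modeRR f u r t + κ * modeRT f u r t) r := by
  refine (hasDerivAt_mode_fderiv hu hf hτ hτr hr (v := fun ω => ((ω : E3), 0))
    (by fun_prop)).congr_deriv ?_
  simp only [modeRR, modeRT]
  congr 3
  ext ω
  rw [hess_comm (contDiffAt_of_cone hu (smul_mem_openCone hr ω))]

lemma hasDerivAt_modeT (hu : ContDiffOn ℝ 2 u cone) (hf : Continuous f)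
    (hτ : ∀ s, HasDerivAt τ κ s) (hτr : τ r = t) (hr : |r| < t) :
    HasDerivAt (fun s => modeT f u s (τ s)) (modeRT f u r t + κ * modeTT f u r t) r :=
  hasDerivAt_mode_fderiv hu hf hτ hτr hr (v := fun _ => (0, 1)) (by fun_prop)

lemma integral_lin_comb {f₁ f₂ f₃ f₄ f₅ f₆ : S2 → ℝ} {c₁ c₂ c₃ c₄ : ℝ} (h₁ : Integrable f₁ sphMeas)
    (h₂ : Integrable f₂ sphMeas) (h₃ : Integrable f₃ sphMeas) (h₄ : Integrable f₄ sphMeas)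
    (h₅ : Integrable f₅ sphMeas) (h₆ : Integrable f₆ sphMeas) :
    ∫ ω, c₁ * (f₁ ω - f₂ ω - f₃ ω) - c₂ * f₄ ω + (c₃ * f₅ ω - c₄ * f₆ ω) ∂sphMeas =
      c₁ * (∫ ω, f₁ ω ∂sphMeas - ∫ ω, f₂ ω ∂sphMeas - ∫ ω, f₃ ω ∂sphMeas) -
        c₂ * ∫ ω, f₄ ω ∂sphMeas + (c₃ * ∫ ω, f₅ ω ∂sphMeas - c₄ * ∫ ω, f₆ ω ∂sphMeas) := by
  have k₁ : Integrable (fun ω => f₁ ω - f₂ ω) sphMeas := h₁.sub h₂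
  have k₂ : Integrable (fun ω => f₁ ω - f₂ ω - f₃ ω) sphMeas := k₁.sub h₃
  have k₃ : Integrable (fun ω => c₁ * (f₁ ω - f₂ ω - f₃ ω) - c₂ * f₄ ω) sphMeas :=
    (k₂.const_mul c₁).sub (h₄.const_mul c₂)
  have k₄ : Integrable (fun ω => c₃ * f₅ ω - c₄ * f₆ ω) sphMeas :=
    (h₅.const_mul c₃).sub (h₆.const_mul c₄)
  rw [integral_add k₃ k₄, integral_sub (k₂.const_mul c₁) (h₄.const_mul c₂), integral_const_mul,
    integral_sub k₁ h₃, integral_sub h₁ h₂, integral_const_mul,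
    integral_sub (h₅.const_mul c₃) (h₆.const_mul c₄), integral_const_mul, integral_const_mul]

/-- The equation satisfied by the spherical means of a solution of the wave equation. -/
lemma mode_wave (hu : ContDiffOn ℝ 2 u cone) {h : E3 × ℝ → ℝ} (hh : ContinuousOn h openCone)
    (heq : ∀ p ∈ openCone, hess u p (0, 1) (0, 1) - ∑ i, hess u p (basis3 i, 0) (basis3 i, 0) = h p)
    (a : E3) (l : ℕ) (hr : |r| < t) :
    r * (2 * modeR (linPow a l) u r t + r * (modeRR (linPow a l) u r t - modeTT (linPow a l) u r t)) =
      l * (l + 1) * modeI (linPow a l) u r t -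
        l * (l - 1 : ℕ) * ‖a‖ ^ 2 * modeI (linPow a (l - 2)) u r t -
        r ^ 2 * modeI (linPow a l) h r t := by
  have key := integral_sphere_laplacian
    (fun ω => contDiffAt_of_cone hu (smul_mem_openCone hr ω)) a l
  have hI : ∀ k, Integrable (fun ω : S2 => u (r • (ω : E3), t) * linPow a k ω) sphMeas := fun k =>
    integrable_sphere (((hu.continuousOn.mono openCone_subset_cone).comp_sphere hr).mul (by fun_prop))
  have hh' : Integrable (fun ω : S2 => h (r • (ω : E3), t) * linPow a l ω) sphMeas :=
    integrable_sphere ((hh.comp_sphere hr).mul (by fun_prop))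
  have hcR : Integrable (fun ω : S2 => fderiv ℝ u (r • (ω : E3), t) ((ω : E3), 0) * linPow a l ω)
      sphMeas :=
    integrable_sphere ((((continuousOn_fderiv_openCone hu).comp_sphere hr).clm_apply
      (by fun_prop)).mul (by fun_prop))
  have hH := (continuousOn_hess_openCone hu).comp_sphere hr
  have hcRR : Integrable (fun ω : S2 =>
      hess u (r • (ω : E3), t) ((ω : E3), 0) ((ω : E3), 0) * linPow a l ω) sphMeas :=
    integrable_sphere (((hH.clm_apply (by fun_prop)).clm_apply (by fun_prop)).mul (by fun_prop))
  have hcTT : Integrable (fun ω : S2 =>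
      hess u (r • (ω : E3), t) (0, 1) (0, 1) * linPow a l ω) sphMeas :=
    integrable_sphere (((hH.clm_apply (by fun_prop)).clm_apply (by fun_prop)).mul (by fun_prop))
  have hL : (∫ ω : S2, (r ^ 2 * (∑ i, hess u (r • (ω : E3), t) (basis3 i, 0) (basis3 i, 0) -
        hess u (r • (ω : E3), t) ((ω : E3), 0) ((ω : E3), 0)) -
        2 * r * fderiv ℝ u (r • (ω : E3), t) ((ω : E3), 0)) * linPow a l ω -
      u (r • (ω : E3), t) * (l * (l - 1 : ℕ) * ‖a‖ ^ 2 * linPow a (l - 2) ω -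
        l * (l + 1) * linPow a l ω) ∂sphMeas) =
      r ^ 2 * (modeTT (linPow a l) u r t - modeI (linPow a l) h r t - modeRR (linPow a l) u r t) -
        2 * r * modeR (linPow a l) u r t + (l * (l + 1) * modeI (linPow a l) u r t -
        l * (l - 1 : ℕ) * ‖a‖ ^ 2 * modeI (linPow a (l - 2)) u r t) := by
    simp only [modeTT, modeI, modeRR, modeR]
    rw [← integral_lin_comb hcTT hh' hcRR hcR (hI l) (hI (l - 2))]
    refine integral_congr_ae (Filter.Eventually.of_forall fun ω => ?_)
    have := heq _ (smul_mem_openCone hr ω)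
    simp only
    linear_combination (-r ^ 2 * linPow a l ω) * this
  rw [hL] at key
  linear_combination -key

end

/-- The weighted spherical mean of a function on `ℝ³`. -/
def modeQ (f q : E3 → ℝ) (r : ℝ) : ℝ := ∫ ω : S2, q (r • (ω : E3)) * f ω ∂sphMeas

section

variable {u : E3 × ℝ → ℝ} {f q : E3 → ℝ}

lemma continuous_integral_sphere {F : ℝ → S2 → ℝ} (hF : Continuous fun z : ℝ × S2 => F z.1 z.2) :
    Continuous fun s => ∫ ω, F s ω ∂sphMeas := by
  simpa using continuous_parametric_integral_of_continuous (μ := sphMeas) (f := F) hF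
    (isCompact_univ (X := S2))

lemma continuous_modeQ (hf : Continuous f) (hq : Continuous q) : Continuous (modeQ f q) :=
  continuous_integral_sphere (by fun_prop)

/-- On bounded parts of the cone, the spherical means of a `C²` function and of its first
derivatives are bounded. -/
lemma exists_mode_bound (hu : ContDiffOn ℝ 2 u cone) (hf : Continuous f) (T : ℝ) :
    ∃ B, ∀ r t, 0 ≤ r → r < t → t ≤ T →
      |modeI f u r t| ≤ B ∧ |modeR f u r t| ≤ B ∧ |modeT f u r t| ≤ B := by
  obtain ⟨B₁, h₁⟩ := (isCompact_coneUpTo T).exists_bound_of_continuousOn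
    (hu.continuousOn.mono inter_subset_left)
  obtain ⟨B₂, h₂⟩ := (isCompact_coneUpTo T).exists_bound_of_continuousOn
    ((continuousOn_fderivWithin_cone hu).mono inter_subset_left)
  obtain ⟨B₃, h₃⟩ := (isCompact_univ (X := S2)).exists_bound_of_continuousOn
    (f := fun ω : S2 => f ω) (Continuous.continuousOn (by fun_prop))
  refine ⟨max B₁ B₂ * B₃ * sphMeas.real univ, fun r t hr hrt htT => ?_⟩
  have hp : ∀ ω : S2, (r • (ω : E3), t) ∈ openCone :=
    smul_mem_openCone (by rwa [abs_of_nonneg hr])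
  have hpT : ∀ ω : S2, (r • (ω : E3), t) ∈ coneUpTo T := fun ω =>
    ⟨openCone_subset_cone (hp ω), htT⟩
  have key : ∀ F : S2 → ℝ, (∀ ω, ‖F ω‖ ≤ max B₁ B₂) →
      |∫ ω, F ω * f ω ∂sphMeas| ≤ max B₁ B₂ * B₃ * sphMeas.real univ := fun F hF => by
    refine norm_integral_le_of_norm_le_const (μ := sphMeas) (f := fun ω => F ω * f ω)
      (Filter.Eventually.of_forall fun ω => ?_)
    rw [norm_mul]
    exact mul_le_mul (hF ω) (h₃ ω (mem_univ _)) (norm_nonneg _) ((norm_nonneg _).trans (hF ω))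
  have hD : ∀ (ω : S2) (v : E3 × ℝ), ‖v‖ ≤ 1 →
      ‖fderiv ℝ u (r • (ω : E3), t) v‖ ≤ max B₁ B₂ := fun ω v hv => by
    have := h₂ _ (hpT ω)
    rw [fderivWithin_cone (hp ω)] at this
    exact ((ContinuousLinearMap.le_opNorm_of_le _ hv).trans (by simpa using this)).trans
      (le_max_right _ _)
  exact ⟨key _ fun ω => (h₁ _ (hpT ω)).trans (le_max_left _ _),
    key _ fun ω => hD ω _ (by simp [Prod.norm_def]),
    key _ fun ω => hD ω _ (by simp [Prod.norm_def])⟩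

lemma hasDerivAt_mul_modeI (hu : ContDiffOn ℝ 2 u cone) (hf : Continuous f) {r t κ : ℝ}
    {τ : ℝ → ℝ} (hτ : ∀ s, HasDerivAt τ κ s) (hτr : τ r = t) (hr : |r| < t) :
    HasDerivAt (fun s => s * modeI f u s (τ s))
      (modeI f u r t + r * (modeR f u r t + κ * modeT f u r t)) r := by
  refine ((hasDerivAt_id' r).fun_mul (hasDerivAt_modeI hu hf hτ hτr hr)).congr_deriv ?_
  rw [hτr, one_mul]

/-- The derivative of a characteristic derivative of `r * modeI f u r t` along the other
characteristic. -/
lemma hasDerivAt_characteristic (hu : ContDiffOn ℝ 2 u cone) (hf : Continuous f) {r t κ c : ℝ}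
    {τ : ℝ → ℝ} (hτ : ∀ s, HasDerivAt τ κ s) (hτr : τ r = t) (hr : |r| < t) (hκ : κ * κ = 1)
    (hc : c = -κ) :
    HasDerivAt (fun s => modeI f u s (τ s) + s * (modeR f u s (τ s) + c * modeT f u s (τ s)))
      (2 * modeR f u r t + r * (modeRR f u r t - modeTT f u r t)) r := by
  refine ((hasDerivAt_modeI hu hf hτ hτr hr).fun_add ((hasDerivAt_id' r).fun_mul
    ((hasDerivAt_modeR hu hf hτ hτr hr).fun_add
      ((hasDerivAt_modeT hu hf hτ hτr hr).const_mul c)))).congr_deriv ?_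
  rw [hτr, hc]
  linear_combination -r * modeTT f u r t * hκ

lemma tendsto_modeI (hu : ContinuousOn u cone) (hf : Continuous f) {r : ℝ} (hr : 0 ≤ r) :
    Filter.Tendsto (fun δ => modeI f u r (r + δ)) (nhdsWithin 0 (Ioi 0)) (nhds (modeI f u r r)) := by
  have hc : Continuous fun δ => ∫ ω : S2, u (r • (ω : E3), r + max 0 δ) * f ω ∂sphMeas := by
    refine continuous_integral_sphere (F := fun δ ω => u (r • (ω : E3), r + max 0 δ) * f ω) ?_
    refine (hu.comp_continuous (f := fun z : ℝ × S2 => (r • (z.2 : E3), r + max 0 z.1))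
      (by fun_prop) fun z => ?_).mul (by fun_prop)
    simp [cone, norm_smul, abs_of_nonneg hr]
  have h0 : (∫ ω : S2, u (r • (ω : E3), r + max 0 0) * f ω ∂sphMeas) = modeI f u r r := by
    simp [modeI]
  rw [← h0]
  refine ((hc.tendsto 0).mono_left nhdsWithin_le_nhds).congr' ?_
  filter_upwards [self_mem_nhdsWithin] with δ hδ
  rw [modeI, max_eq_right (le_of_lt hδ)]

/-- The spherical means of the Goursat data, as an antiderivative. -/
lemma modeI_diagonal (hq : Continuous q) (hf : Continuous f)
    (hic : ∀ x : E3, u (x, ‖x‖) = ∫ σ in (0:ℝ)..1, q (σ • x)) {r r' : ℝ} (hr : 0 ≤ r)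
    (hr' : r ≤ r') :
    r' * modeI f u r' r' - r * modeI f u r r = ∫ s in r..r', modeQ f q s := by
  have hV : ∀ r, 0 ≤ r → r * modeI f u r r =
      ∫ ω : S2, (∫ s in (0:ℝ)..r, q (s • (ω : E3))) * f ω ∂sphMeas := fun r hr => by
    rw [modeI, ← integral_const_mul]
    refine integral_congr_ae (Filter.Eventually.of_forall fun ω => ?_)
    have h1 := hic (r • (ω : E3))
    rw [norm_smul, norm_coe_sphere, mul_one, Real.norm_of_nonneg hr] at h1
    have h2 := intervalIntegral.mul_integral_comp_mul_right (a := 0) (b := 1) r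
      (f := fun s => q (s • (ω : E3)))
    rw [zero_mul, one_mul] at h2
    simp only [h1, ← h2, smul_smul]
    ring
  have hd : ∀ s, HasDerivAt
      (fun s => ∫ ω : S2, (∫ σ in (0:ℝ)..s, q (σ • (ω : E3))) * f ω ∂sphMeas) (modeQ f q s) s := by
    intro s
    refine hasDerivAt_integral_sphere (F := fun s ω => (∫ σ in (0:ℝ)..s, q (σ • (ω : E3))) * f ω)
      (F' := fun s ω => q (s • (ω : E3)) * f ω) Filter.univ_mem (fun s _ => ?_)
      (Continuous.continuousOn (by fun_prop)) fun s _ ω => ?_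
    · exact (intervalIntegral.continuous_parametric_intervalIntegral_of_continuous'
        (f := fun (ω : S2) σ => q (σ • (ω : E3))) (by fun_prop) 0 s).mul (by fun_prop)
    · exact (intervalIntegral.integral_hasDerivAt_right
        (Continuous.intervalIntegrable (by fun_prop) _ _)
        (Continuous.stronglyMeasurableAtFilter (by fun_prop) _ _)
        (Continuous.continuousAt (by fun_prop))).mul_const _
  rw [hV r hr, hV r' (hr.trans hr'), intervalIntegral.integral_eq_sub_of_hasDerivAt (fun s _ => hd s)
    ((continuous_modeQ hf hq).intervalIntegrable _ _)]

end

/-- All moments of `q` on the spheres of radius less than `(R + T) / 2` vanish. -/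
lemma moments_eq_zero {R T : ℝ} (hR : 0 < R) (hRT : R < T) {qb q : E3 → ℝ} {ub u : E3 × ℝ → ℝ}
    (hqb : Continuous qb) (hqbr : ∀ x y : E3, ‖x‖ = ‖y‖ → qb x = qb y)
    (hub : ContinuousOn ub cone)
    (hubr : ∀ (x y : E3) (t : ℝ), ‖x‖ = ‖y‖ → ‖x‖ ≤ t → ub (x, t) = ub (y, t))
    (hq : Continuous q) (hu : ContDiffOn ℝ 2 u cone)
    (heq : ∀ p ∈ openCone, hess u p (0, 1) (0, 1) - ∑ i, hess u p (basis3 i, 0) (basis3 i, 0) =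
      qb p.1 * u p + q p.1 * ub p)
    (hic : ∀ x : E3, u (x, ‖x‖) = ∫ σ in (0:ℝ)..1, q (σ • x))
    (hC : ∀ p : E3 × ℝ, ‖p.1‖ = R → R < p.2 → p.2 ≤ T →
      u p = 0 ∧ fderiv ℝ u p (p.1, 0) = 0 ∧ fderiv ℝ u p (0, 1) = 0) (a : E3) (l : ℕ) :
    (∀ r t, R ≤ r → r < t → t + r ≤ R + T → modeI (linPow a l) u r t = 0) ∧
      ∀ r, R ≤ r → r < (R + T) / 2 → modeQ (linPow a l) q r = 0 := by
  induction l using Nat.strong_induction_on with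
  | _ l ih =>
  have hf := continuous_linPow a l
  have hT : 0 < T := hR.trans hRT
  have hlow : ∀ r t, R ≤ r → r < t → t + r ≤ R + T →
      (l : ℝ) * (l - 1 : ℕ) * ‖a‖ ^ 2 * modeI (linPow a (l - 2)) u r t = 0 := fun r t h1 h2 h3 => by
    rcases Nat.lt_or_ge l 2 with hl | hl
    · have : l - 1 = 0 ∨ l = 0 := by omega
      rcases this with h | h <;> simp [h]
    · rw [(ih (l - 2) (by omega)).1 r t h1 h2 h3, mul_zero]
  obtain ⟨B, hB⟩ := exists_mode_bound hu hf T
  obtain ⟨Bq, hBq⟩ := (isCompact_closedBall (0 : E3) T).exists_bound_of_continuousOn hqb.continuousOn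
  obtain ⟨Bu, hBu⟩ := (isCompact_coneUpTo T).exists_bound_of_continuousOn
    (hub.mono inter_subset_left)
  set e : E3 := basis3 0 with he
  have hne : ‖e‖ = 1 := by simp [he, basis3]
  have habs : ∀ r t, R ≤ r → r < t → |r| < t := fun r t h1 h2 => by
    rwa [abs_of_nonneg (hR.le.trans h1)]
  have hright : ∀ r t, R ≤ r → r < t →
      modeI (linPow a l) (fun p => qb p.1 * u p + q p.1 * ub p) r t =
        qb (r • e) * modeI (linPow a l) u r t + ub (r • e, t) * modeQ (linPow a l) q r := by
    intro r t h1 h2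
    have i₁ : Integrable (fun ω : S2 => u (r • (ω : E3), t) * linPow a l ω) sphMeas :=
      integrable_sphere (((hu.continuousOn.mono openCone_subset_cone).comp_sphere
        (habs r t h1 h2)).mul (by fun_prop))
    have i₂ : Integrable (fun ω : S2 => q (r • (ω : E3)) * linPow a l ω) sphMeas :=
      integrable_sphere (by fun_prop)
    rw [modeI, modeI, modeQ, ← integral_const_mul, ← integral_const_mul,
      ← integral_add (i₁.const_mul _) (i₂.const_mul _)]
    refine integral_congr_ae (Filter.Eventually.of_forall fun ω => ?_)
    have hn : ‖r • (ω : E3)‖ = ‖r • e‖ := by simp [norm_smul, hne]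
    have hle : ‖r • (ω : E3)‖ ≤ t := by
      rw [norm_smul, norm_coe_sphere, mul_one]
      exact (habs r t h1 h2).le
    simp only
    rw [hqbr _ _ hn, hubr _ _ t hn hle]
    ring
  have hcontr : ContinuousOn (fun p : E3 × ℝ => qb p.1 * u p + q p.1 * ub p) openCone :=
    ((hqb.comp continuous_fst).continuousOn.mul (hu.continuousOn.mono openCone_subset_cone)).add
      ((hq.comp continuous_fst).continuousOn.mul (hub.mono openCone_subset_cone))
  have hτ₁ : ∀ r t s : ℝ, HasDerivAt (fun s => t - r + s) 1 s := fun r t s =>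
    (hasDerivAt_id s).const_add _
  have hτ₂ : ∀ r t s : ℝ, HasDerivAt (fun s => t + r - s) (-1) s := fun r t s =>
    (hasDerivAt_id s).const_sub _
  have key := sideways_unique (R := R) (T := T)
    (C := l * (l + 1) / R ^ 2 + max Bq 0 + T * max Bu 0)
    (V := fun r t => r * modeI (linPow a l) u r t)
    (a := fun r t => modeI (linPow a l) u r t +
      r * (modeR (linPow a l) u r t + 1 * modeT (linPow a l) u r t))
    (b := fun r t => modeI (linPow a l) u r t +
      r * (modeR (linPow a l) u r t + (-1) * modeT (linPow a l) u r t))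
    (g := fun r t => 2 * modeR (linPow a l) u r t +
          r * (modeRR (linPow a l) u r t - modeTT (linPow a l) u r t))
    (Q := modeQ (linPow a l) q) ?_ ?_ ?_ ?_ ?_ ?_ ?_ ?_ (continuous_modeQ hf hq) ?_ ?_
  · refine ⟨fun r t h1 h2 h3 => ?_, key.2⟩
    exact (mul_eq_zero.1 (key.1 r t h1 h2 h3)).resolve_left (hR.trans_le h1).ne'
  · positivity
  · refine ⟨max (T * B) (B + T * (B + B)), fun r t h1 h2 h3 => ?_⟩
    obtain ⟨b₁, b₂, b₃⟩ := hB r t (hR.le.trans h1) h2 (by linarith)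
    have hr0 : 0 ≤ r := hR.le.trans h1
    have hrT : r ≤ T := by linarith
    have hB0 : 0 ≤ B := (abs_nonneg _).trans b₁
    have hmul : ∀ {x K : ℝ}, |x| ≤ K → 0 ≤ K → |r * x| ≤ T * K := fun {x K} hx hK => by
      rw [abs_mul, abs_of_nonneg hr0]
      exact mul_le_mul hrT hx (abs_nonneg _) hT.le
    have hsum : ∀ c : ℝ, |c| = 1 → |modeI (linPow a l) u r t +
        r * (modeR (linPow a l) u r t + c * modeT (linPow a l) u r t)| ≤ B + T * (B + B) :=
      fun c hc => by
        have h4 : |c * modeT (linPow a l) u r t| ≤ B := by rwa [abs_mul, hc, one_mul]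
        exact (abs_add_le _ _).trans (add_le_add b₁
          (hmul ((abs_add_le _ _).trans (add_le_add b₂ h4)) (by linarith)))
    exact ⟨(hmul b₁ hB0).trans (le_max_left _ _), (hsum 1 (by simp)).trans (le_max_right _ _),
      (hsum (-1) (by simp)).trans (le_max_right _ _)⟩
  · intro r t h1 h2 _
    refine (hasDerivAt_mul_modeI hu hf (κ := 0) (τ := fun _ => t) (fun s => hasDerivAt_const s t) rfl
      (habs r t h1 h2)).congr_deriv ?_
    ring
  · intro r t h1 h2 _
    exact hasDerivAt_mul_modeI hu hf (hτ₁ r t) (by ring) (habs r t h1 h2)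
  · intro r t h1 h2 _
    exact hasDerivAt_characteristic hu hf (hτ₂ r t) (by ring) (habs r t h1 h2) (by norm_num)
      (by norm_num)
  · intro r t h1 h2 _
    exact hasDerivAt_characteristic hu hf (hτ₁ r t) (by ring) (habs r t h1 h2) (by norm_num)
      (by norm_num)
  · intro r t h1 h2 h3
    have hr0 : 0 < r := hR.trans_le h1
    have hrT : r ≤ T := by linarith
    have hw := mode_wave hu hcontr heq a l (habs r t h1 h2)
    rw [hlow r t h1 h2 h3, hright r t h1 h2] at hw
    have hn : ‖r • e‖ = r := by rw [norm_smul, hne, mul_one, Real.norm_of_nonneg hr0.le]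
    have hqB : |qb (r • e)| ≤ max Bq 0 :=
      (hBq _ (by rw [mem_closedBall_zero_iff, hn]; exact hrT)).trans (le_max_left _ _)
    have huB : |ub (r • e, t)| ≤ max Bu 0 := by
      refine (hBu (r • e, t) ⟨?_, ?_⟩).trans (le_max_left _ _)
      · change ‖r • e‖ ≤ t
        rw [hn]; exact h2.le
      · change t ≤ T
        linarith
    set I := modeI (linPow a l) u r t
    set Q := modeQ (linPow a l) q r
    set g := 2 * modeR (linPow a l) u r t +
      r * (modeRR (linPow a l) u r t - modeTT (linPow a l) u r t)
    have hg : g = l * (l + 1) / r ^ 2 * (r * I) - (qb (r • e) * (r * I) + r * ub (r • e, t) * Q) := by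
      refine mul_left_cancel₀ hr0.ne' (hw.trans ?_)
      field_simp
      ring
    rw [hg]
    have k₁ : |(l * (l + 1) / r ^ 2 * (r * I) : ℝ)| ≤ l * (l + 1) / R ^ 2 * |r * I| := by
      rw [abs_mul, abs_of_nonneg (by positivity)]
      gcongr
    have k₂ : |qb (r • e) * (r * I)| ≤ max Bq 0 * |r * I| := by
      rw [abs_mul]
      gcongr
    have k₃ : |r * ub (r • e, t) * Q| ≤ T * max Bu 0 * |Q| := by
      rw [abs_mul, abs_mul, abs_of_pos hr0]
      gcongr
    have k₄ := abs_sub (l * (l + 1) / r ^ 2 * (r * I)) (qb (r • e) * (r * I) + r * ub (r • e, t) * Q)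
    have k₅ := abs_add_le (qb (r • e) * (r * I)) (r * ub (r • e, t) * Q)
    have k₆ : 0 ≤ l * (l + 1) / R ^ 2 * |Q| := by positivity
    have k₇ : 0 ≤ max Bq 0 * |Q| := by positivity
    have k₈ : 0 ≤ T * max Bu 0 * |r * I| := by positivity
    linarith
  · intro t h1 h2
    have hd : ∀ ω : S2, _ := fun ω => hC (R • (ω : E3), t)
      (by rw [norm_smul, norm_coe_sphere, mul_one, Real.norm_of_nonneg hR.le]) h1 h2
    have hI : modeI (linPow a l) u R t = 0 :=
      integral_eq_zero_of_ae (Filter.Eventually.of_forall fun ω => by simp [(hd ω).1])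
    have hRd : modeR (linPow a l) u R t = 0 :=
      integral_eq_zero_of_ae (Filter.Eventually.of_forall fun ω => by
        have h4 : R * fderiv ℝ u (R • (ω : E3), t) ((ω : E3), 0) = 0 := by
          rw [← smul_eq_mul, ← map_smul, Prod.smul_mk, smul_zero]
          exact (hd ω).2.1
        simp [(mul_eq_zero.1 h4).resolve_left hR.ne'])
    have hTd : modeT (linPow a l) u R t = 0 :=
      integral_eq_zero_of_ae (Filter.Eventually.of_forall fun ω => by simp [(hd ω).2.2])
    simp [hI, hRd, hTd]
  · intro r h1
    exact ((tendsto_modeI hu.continuousOn hf (hR.le.trans h1)).const_mul r)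
  · intro r r' h1 h2
    exact modeI_diagonal hq hf hic (hR.le.trans h1) h2

/-- The exponential of a linear form, on the sphere. -/
def expForm (a : E3) : C(S2, ℝ) := ⟨fun ω => exp (inner ℝ a (ω : E3)), by fun_prop⟩

/-- Products of exponentials of linear forms are again of this form. -/
lemma mem_closure_expForm {f : C(S2, ℝ)} (hf : f ∈ Submonoid.closure (range expForm)) :
    ∃ a, expForm a = f := by
  induction hf using Submonoid.closure_induction with
  | mem f hf => exact hf
  | one => exact ⟨0, by ext ω; simp [expForm]⟩
  | mul f g _ _ hf hg =>
    obtain ⟨a, rfl⟩ := hf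
    obtain ⟨b, rfl⟩ := hg
    exact ⟨a + b, by ext ω; simp [expForm, inner_add_left, exp_add]⟩

lemma separatesPoints_expForm : (Algebra.adjoin ℝ (range expForm)).SeparatesPoints := by
  intro ω₁ ω₂ hne
  refine ⟨expForm ((ω₁ : E3) - ω₂), ⟨_, Algebra.subset_adjoin ⟨_, rfl⟩, rfl⟩, fun h => hne ?_⟩
  have h' := exp_injective h
  have : inner ℝ ((ω₁ : E3) - ω₂) ((ω₁ : E3) - ω₂) = 0 := by
    rw [inner_sub_right, h', sub_self]
  exact Subtype.ext (sub_eq_zero.1 (inner_self_eq_zero.1 this))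

/-- A continuous function on the sphere all of whose moments vanish is orthogonal to the
exponentials of linear forms. -/
lemma integral_mul_expForm {g : C(S2, ℝ)}
    (hg : ∀ a l, ∫ ω, g ω * linPow a l ω ∂sphMeas = 0) (a : E3) :
    ∫ ω, g ω * expForm a ω ∂sphMeas = 0 := by
  have key := hasSum_integral_of_dominated_convergence (μ := sphMeas)
    (F := fun (n : ℕ) (ω : S2) => g ω * (inner ℝ a (ω : E3) ^ n / n.factorial))
    (f := fun ω => g ω * expForm a ω) (fun n _ => ‖g‖ * (‖a‖ ^ n / n.factorial))
    (fun n => Continuous.aestronglyMeasurable (by fun_prop))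
    (fun n => Filter.Eventually.of_forall fun ω => ?_)
    (Filter.Eventually.of_forall fun ω => (Real.summable_pow_div_factorial _).mul_left _)
    (integrable_const _)
    (Filter.Eventually.of_forall fun ω => ?_)
  · refine key.unique ?_
    have h0 : ∀ n : ℕ, ∫ ω : S2, g ω * (inner ℝ a (ω : E3) ^ n / n.factorial) ∂sphMeas = 0 := by
      intro n
      have := hg a n
      simp only [linPow] at this
      simp_rw [← mul_div_assoc, integral_div, this, zero_div]
    simp only [h0]
    exact hasSum_zero
  · rw [norm_mul, norm_div, norm_pow, Real.norm_natCast]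
    have h1 : ‖inner ℝ a (ω : E3)‖ ≤ ‖a‖ := by
      simpa [norm_coe_sphere] using norm_inner_le_norm (𝕜 := ℝ) a (ω : E3)
    gcongr
    exact g.norm_coe_le_norm ω
  · refine HasSum.mul_left _ ?_
    have := NormedSpace.expSeries_div_hasSum_exp (inner ℝ a (ω : E3))
    rwa [← Real.exp_eq_exp_ℝ] at this

lemma continuous_integral_mul (g : C(S2, ℝ)) :
    Continuous fun f : C(S2, ℝ) => ∫ ω, g ω * f ω ∂sphMeas := by
  refine (LipschitzWith.of_dist_le_mul (K := ‖g‖₊ * (sphMeas univ).toNNReal) fun f₁ f₂ => ?_).continuous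
  rw [dist_eq_norm, dist_eq_norm, ← integral_sub (integrable_sphere (by fun_prop))
    (integrable_sphere (by fun_prop))]
  refine (norm_integral_le_of_norm_le_const (μ := sphMeas) (C := ‖g‖ * ‖f₁ - f₂‖)
    (Filter.Eventually.of_forall fun ω => ?_)).trans_eq ?_
  · rw [← mul_sub, norm_mul]
    exact mul_le_mul (g.norm_coe_le_norm ω) ((f₁ - f₂).norm_coe_le_norm ω) (norm_nonneg _)
      (norm_nonneg _)
  · rw [Measure.real, NNReal.coe_mul, coe_nnnorm, ENNReal.coe_toNNReal_eq_toReal]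
    ring

/-- A continuous function on the sphere all of whose moments vanish is zero. -/
lemma eq_zero_of_moments {g : C(S2, ℝ)}
    (hg : ∀ a l, ∫ ω, g ω * linPow a l ω ∂sphMeas = 0) (ω : S2) : g ω = 0 := by
  have hclosed : IsClosed {f : C(S2, ℝ) | ∫ ω, g ω * f ω ∂sphMeas = 0} :=
    isClosed_eq (continuous_integral_mul g) continuous_const
  have hsub : ((Algebra.adjoin ℝ (range expForm) : Subalgebra ℝ C(S2, ℝ)) : Set C(S2, ℝ)) ⊆
      {f | ∫ ω, g ω * f ω ∂sphMeas = 0} := by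
    intro f hf
    rw [SetLike.mem_coe, ← Subalgebra.mem_toSubmodule, Algebra.adjoin_eq_span] at hf
    induction hf using Submodule.span_induction with
    | mem f hf =>
      obtain ⟨a, rfl⟩ := mem_closure_expForm hf
      exact integral_mul_expForm hg a
    | zero => simp
    | add f₁ f₂ _ _ h₁ h₂ =>
      simp only [mem_ofPred_eq, ContinuousMap.add_apply, mul_add] at h₁ h₂ ⊢
      rw [integral_add (integrable_sphere (by fun_prop)) (integrable_sphere (by fun_prop)), h₁, h₂,
        add_zero]
    | smul c f _ h =>
      simp only [mem_ofPred_eq, ContinuousMap.smul_apply, smul_eq_mul, mul_left_comm (_ : ℝ) c] at h ⊢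
      rw [integral_const_mul, h, mul_zero]
  have hmem : g ∈ (Algebra.adjoin ℝ (range expForm)).topologicalClosure := by
    rw [ContinuousMap.subalgebra_topologicalClosure_eq_top_of_separatesPoints _
      separatesPoints_expForm]
    exact Algebra.mem_top
  have hgg : ∫ ω, g ω * g ω ∂sphMeas = 0 := closure_minimal hsub hclosed hmem
  rw [integral_eq_zero_iff_of_nonneg (fun ω => mul_self_nonneg (g ω))
    (integrable_sphere (by fun_prop))] at hgg
  have := (Continuous.ae_eq_iff_eq sphMeas (by fun_prop) continuous_const).1 hgg
  exact mul_self_eq_zero.1 (congr_fun this ω)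

lemma fderiv_time_eq_zero {u : E3 × ℝ → ℝ} {x : E3} {a t : ℝ} (hat : a < t)
    (hu : DifferentiableAt ℝ u (x, t)) (h : ∀ s ∈ Icc a t, u (x, s) = 0) :
    fderiv ℝ u (x, t) (0, 1) = 0 := by
  have h1 : HasDerivAt (fun s => u (x, s)) (fderiv ℝ u (x, t) (0, 1)) t :=
    hu.hasFDerivAt.comp_hasDerivAt (f := fun s : ℝ => ((x, s) : E3 × ℝ)) t
      ((hasDerivAt_const t x).prodMk (hasDerivAt_id t))
  have ht : t ∈ Icc a t := right_mem_Icc.2 hat.le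
  exact (uniqueDiffOn_Icc hat t ht).eq_deriv _ h1.hasDerivWithinAt
    ((hasDerivWithinAt_const t (Icc a t) (0 : ℝ)).congr h (h t ht))

lemma eq_zero_of_modeQ_eq_zero {q : E3 → ℝ} (hq : Continuous q) {x : E3} (hx : 0 < ‖x‖)
    (h : ∀ a l, modeQ (linPow a l) q ‖x‖ = 0) : q x = 0 := by
  have hω : ‖x‖⁻¹ • x ∈ sphere (0 : E3) 1 := by
    rw [mem_sphere_zero_iff_norm, norm_smul, norm_inv, norm_norm, inv_mul_cancel₀ hx.ne']
  have := eq_zero_of_moments (g := ⟨fun ω : S2 => q (‖x‖ • (ω : E3)), by fun_prop⟩) h ⟨_, hω⟩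
  simpa [smul_smul, hx.ne'] using this

/-- **Theorem 1.4.** Uniqueness for the inverse problem linearized about a
radial background: if the Cauchy data of the solution `u` of the linearized Goursat problem
vanishes on the cylinder `|x| = R`, `R ≤ t ≤ T`, then `q = 0` on `R ≤ |x| ≤ (R+T)/2`. -/
theorem stmt4 (R T : ℝ) (hR : 0 < R) (hRT : R < T)
    (qb : E3 → ℝ) (hqb : ContDiff ℝ (⊤ : ℕ∞) qb)
    (hrad : ∀ x y : E3, ‖x‖ = ‖y‖ → qb x = qb y)
    (ub : E3 × ℝ → ℝ) (hub : GoursatSol qb ub)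
    (q : E3 → ℝ) (hq : ContDiff ℝ (⊤ : ℕ∞) q)
    (u : E3 × ℝ → ℝ) (hu : ContDiffOn ℝ 2 u cone)
    (heq : ∀ p : E3 × ℝ, ‖p.1‖ < p.2 →
      pdt (pdt u) p - lapX u p - qb p.1 * u p = q p.1 * ub p)
    (hic : ∀ x : E3, u (x, ‖x‖) = ∫ σ in (0:ℝ)..1, q (σ • x))
    (hC : ∀ p : E3 × ℝ, ‖p.1‖ = R → R ≤ p.2 → p.2 ≤ T → u p = 0 ∧ pdrX u p = 0) :
    ∀ x : E3, R ≤ ‖x‖ → ‖x‖ ≤ (R + T) / 2 → q x = 0 := by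
  have hcts := hq.continuous
  have hdiff : ∀ p ∈ openCone, ContDiffAt ℝ 2 u p := fun p hp => contDiffAt_of_cone hu hp
  have hmom := moments_eq_zero hR hRT hqb.continuous hrad hub.1.continuousOn
    (fun x y t hxy ht => goursat_radial hqb.continuous hrad hub hxy ht) hcts hu
    (fun p hp => by
      rw [← wave_hess (hdiff p hp)]
      linear_combination heq p hp) hic
    (fun p h1 h2 h3 => by
      have hp : p ∈ openCone := lt_of_eq_of_lt h1 h2
      have hd := (hdiff p hp).differentiableAt (by norm_num)
      obtain ⟨h4, h5⟩ := hC p h1 h2.le h3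
      rw [pdrX_eq hd, h1] at h5
      exact ⟨h4, (mul_eq_zero.1 h5).resolve_left (inv_ne_zero hR.ne'), fderiv_time_eq_zero h2 hd
        fun s hs => (hC (p.1, s) h1 hs.1 (hs.2.trans h3)).1⟩)
  have hopen : ∀ x : E3, R ≤ ‖x‖ → ‖x‖ < (R + T) / 2 → q x = 0 := fun x h1 h2 =>
    eq_zero_of_modeQ_eq_zero hcts (hR.trans_le h1) fun a l => (hmom a l).2 _ h1 h2
  intro x h1 h2
  rcases h2.lt_or_eq with h2 | h2
  · exact hopen x h1 h2
  have hlim : Filter.Tendsto (fun s : ℝ => q (s • x)) (nhdsWithin 1 (Iio 1)) (nhds (q x)) := by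
    have h3 : Continuous fun s : ℝ => q (s • x) := by fun_prop
    simpa using (h3.tendsto 1).mono_left nhdsWithin_le_nhds
  refine tendsto_nhds_unique hlim (tendsto_const_nhds.congr' ?_)
  have hx : R / ‖x‖ < 1 := by
    rw [h2, div_lt_one (by linarith)]
    linarith
  filter_upwards [Ioo_mem_nhdsLT hx] with s hs
  have hx0 : 0 < ‖x‖ := hR.trans_le h1
  have hs0 : 0 < s := (div_pos hR hx0).trans hs.1
  have hn : ‖s • x‖ = s * ‖x‖ := by rw [norm_smul, Real.norm_of_nonneg hs0.le]
  refine (hopen _ ?_ ?_).symm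
  · rw [hn]
    exact ((div_lt_iff₀ hx0).1 hs.1).le
  · rw [hn, ← h2]
    exact mul_lt_of_lt_one_left hx0 hs.2
end
end

section
/- Let f be a C² function on an open subset U of ℝ³ and let x ∈ U with x ≠ 0. Then Δf(x) = ∂_r(∂_r f)(x) + (2/|x|) ∂_r f(x) + |x|^{-2} (Ω f)(x), where Δ is the Laplacian on ℝ³. -/
noncomputable section

open Real MeasureTheory Metric Set

theorem pd_mul {g h : E3 → ℝ} {x : E3} (hg : DifferentiableAt ℝ g x)
    (hh : DifferentiableAt ℝ h x) (k : Fin 3) :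
    pd k (fun y => g y * h y) x = pd k g x * h x + g x * pd k h x := by
  simp only [pd]
  rw [fderiv_fun_mul hg hh]
  simp
  ring

theorem pd_sub {g h : E3 → ℝ} {x : E3} (hg : DifferentiableAt ℝ g x)
    (hh : DifferentiableAt ℝ h x) (k : Fin 3) :
    pd k (fun y => g y - h y) x = pd k g x - pd k h x := by
  simp only [pd]
  rw [fderiv_fun_sub hg hh]
  simp

theorem pd_sum {g : Fin 3 → E3 → ℝ} {x : E3} (hg : ∀ i, DifferentiableAt ℝ (g i) x)
    (k : Fin 3) : pd k (fun y => ∑ i, g i y) x = ∑ i, pd k (g i) x := by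
  simp only [pd]
  rw [fderiv_fun_sum fun i _ => hg i]
  simp

theorem differentiableAt_coord (i : Fin 3) (x : E3) :
    DifferentiableAt ℝ (fun y : E3 => y i) x :=
  (EuclideanSpace.proj i : E3 →L[ℝ] ℝ).differentiableAt

theorem pd_coord (k i : Fin 3) (x : E3) :
    pd k (fun y : E3 => y i) x = if i = k then 1 else 0 := by
  have h : fderiv ℝ (fun y : E3 => y i) x = EuclideanSpace.proj i :=
    (EuclideanSpace.proj i : E3 →L[ℝ] ℝ).hasFDerivAt.fderiv
  simp [pd, h, basis3]

theorem differentiableAt_norm_inv {x : E3} (hx : x ≠ 0) :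
    DifferentiableAt ℝ (fun y : E3 => ‖y‖⁻¹) x :=
  (differentiableAt_id.norm ℝ hx).inv (norm_ne_zero_iff.mpr hx)

theorem pd_norm_inv {x : E3} (hx : x ≠ 0) (k : Fin 3) :
    pd k (fun y : E3 => ‖y‖⁻¹) x = -(x k * ‖x‖⁻¹ ^ 3) := by
  have hn : ‖x‖ ≠ 0 := norm_ne_zero_iff.mpr hx
  have hd : DifferentiableAt ℝ (fun y : E3 => ‖y‖) x := differentiableAt_id.norm ℝ hx
  have hsq : pd k (fun y : E3 => ‖y‖ * ‖y‖) x = 2 * x k := by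
    have h := (hasStrictFDerivAt_norm_sq x).hasFDerivAt.fderiv
    simp only [← pow_two, pd]
    rw [h]
    simp [basis3, EuclideanSpace.inner_single_right]
  rw [pd_mul hd hd] at hsq
  have hnorm : pd k (fun y : E3 => ‖y‖) x = x k * ‖x‖⁻¹ := by
    field_simp
    linarith
  have hinv : pd k (fun y : E3 => ‖y‖⁻¹) x = -(‖x‖ ^ 2)⁻¹ * pd k (fun y : E3 => ‖y‖) x := by
    have h : fderiv ℝ (fun y : E3 => ‖y‖⁻¹) x = -(‖x‖ ^ 2)⁻¹ • fderiv ℝ (fun y : E3 => ‖y‖) x :=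
      ((hasDerivAt_inv hn).comp_hasFDerivAt x hd.hasFDerivAt).fderiv
    simp [pd, h]
  rw [hinv, hnorm]
  field_simp

theorem pd_coord_mul {g : E3 → ℝ} {x : E3} (hg : DifferentiableAt ℝ g x) (k i : Fin 3) :
    pd k (fun y => y i * g y) x = (if i = k then 1 else 0) * g x + x i * pd k g x := by
  rw [pd_mul (differentiableAt_coord i x) hg, pd_coord]

theorem ContDiffAt.differentiableAt_pd {f : E3 → ℝ} {x : E3} (hf : ContDiffAt ℝ 2 f x)
    (i : Fin 3) : DifferentiableAt ℝ (pd i f) x :=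
  ((hf.fderiv_right (m := 1) (by norm_num)).differentiableAt one_ne_zero).clm_apply
    (differentiableAt_const _)

theorem pd_pdr {f : E3 → ℝ} {x : E3} (hf : ContDiffAt ℝ 2 f x) (hx : x ≠ 0) (k : Fin 3) :
    pd k (pdr f) x = -(x k * ‖x‖⁻¹ ^ 3) * ∑ i, x i * pd i f x +
      ‖x‖⁻¹ * (pd k f x + ∑ i, x i * pd k (pd i f) x) := by
  have hterm (i : Fin 3) : DifferentiableAt ℝ (fun y => y i * pd i f y) x :=
    (differentiableAt_coord i x).mul (hf.differentiableAt_pd i)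
  change pd k (fun y => ‖y‖⁻¹ * ∑ i, y i * pd i f y) x = _
  rw [pd_mul (differentiableAt_norm_inv hx) (DifferentiableAt.fun_sum fun i _ => hterm i),
    pd_norm_inv hx, pd_sum hterm]
  simp [pd_coord_mul (hf.differentiableAt_pd _), Finset.sum_add_distrib]

theorem pd_ang {f : E3 → ℝ} {x : E3} (hf : ContDiffAt ℝ 2 f x) (k i j : Fin 3) :
    pd k (ang i j f) x = (if i = k then 1 else 0) * pd j f x + x i * pd k (pd j f) x -
      ((if j = k then 1 else 0) * pd i f x + x j * pd k (pd i f) x) := by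
  change pd k (fun y => y i * pd j f y - y j * pd i f y) x = _
  rw [pd_sub ((differentiableAt_coord i x).fun_mul (hf.differentiableAt_pd j))
    ((differentiableAt_coord j x).fun_mul (hf.differentiableAt_pd i)),
    pd_coord_mul (hf.differentiableAt_pd j), pd_coord_mul (hf.differentiableAt_pd i)]

/-- Polar decomposition of the Laplacian:
`Δf = ∂_r∂_r f + (2/|x|) ∂_r f + |x|^{-2} Ω f`. -/
theorem stmt9 (U : Set E3) (hU : IsOpen U) (f : E3 → ℝ) (hf : ContDiffOn ℝ 2 f U)
    (x : E3) (hx : x ∈ U) (hx0 : x ≠ 0) :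
    lap f x = pdr (pdr f) x + (2 / ‖x‖) * pdr f x + (‖x‖ ^ 2)⁻¹ * angLap f x := by
  have hf' : ContDiffAt ℝ 2 f x := hf.contDiffAt (hU.mem_nhds hx)
  have hn : ‖x‖ ≠ 0 := norm_ne_zero_iff.mpr hx0
  have hsq : ‖x‖ ^ 2 = x 0 ^ 2 + x 1 ^ 2 + x 2 ^ 2 := by
    simp [EuclideanSpace.norm_sq_eq, Fin.sum_univ_three]
  have hang (i j : Fin 3) (hij : i ≠ j) : ang i j (ang i j f) x =
      x i ^ 2 * pd j (pd j f) x + x j ^ 2 * pd i (pd i f) x -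
        x i * x j * (pd i (pd j f) x + pd j (pd i f) x) - x i * pd i f x - x j * pd j f x := by
    rw [ang, pd_ang hf', pd_ang hf']
    simp only [hij, hij.symm, if_true, if_false]
    ring
  have hangLap : angLap f x =
      ‖x‖ ^ 2 * lap f x - (∑ k, x k * ∑ i, x i * pd k (pd i f) x) -
        2 * ∑ i, x i * pd i f x := by
    simp [angLap, lap, Fin.sum_univ_three, hang, hsq]
    ring
  have hpdr : pdr (pdr f) x = (‖x‖ ^ 2)⁻¹ * ∑ k, x k * ∑ i, x i * pd k (pd i f) x := by
    rw [pdr]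
    simp only [pd_pdr hf' hx0, Fin.sum_univ_three]
    field_simp
    rw [hsq]
    ring
  rw [hangLap, hpdr, pdr]
  field_simp
  ring
end
end
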